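/- arXiv:1502.00409 — 4 statements merged into one kernel-verified Lean document; each statement's English description precedes it below -/
import Mathlib

section
/- For every sufficiently large integer n (any n with 8 ≤ (1/648)·log log n suffices) there exists a graph G on n vertices with average degree at least 8 and maximum degree at most 48 such that: (a) for every spanning subgraph G′ of G with |E(G′)| ≥ |E(G)|/2, some connected component of G′ has at least n^{1/4608} vertices (in particular, G is not (1/2, q)-hyperfinite for any q < n^{1/4608}); and (b) every induced subgraph H of G on m ≥ 2 vertices satisfies sep(H) ≤ (m/log m)·(log log m)² + 48. -/
open SimpleGraph

attribute [local instance] Classical.propDecidable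

/-- The set of edges of `G` with exactly one endpoint in `A` (the edge boundary `∂_G(A)`). -/
noncomputable def cutEdges {V : Type*} (G : SimpleGraph V) (A : Set V) : Set (Sym2 V) :=
  {e | e ∈ G.edgeSet ∧ ∃ u ∈ A, ∃ v ∈ Aᶜ, e = s(u, v)}

/-- `sep G`: minimum size of an edge separator of `G`. -/
noncomputable def sep {V : Type*} (G : SimpleGraph V) : ℕ :=
  sInf { m : ℕ | ∃ A : Set V, 3 * A.ncard ≤ 2 * Nat.card V ∧
      3 * Aᶜ.ncard ≤ 2 * Nat.card V ∧ m = (cutEdges G A).ncard }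

/-- Alteration method: a finite ground set contains a large subset that includes none of the
forbidden sets, provided these are few when weighted by `K⁻¹` per element. -/
theorem exists_subset_avoiding {α : Type*} [Fintype α] (E : Finset α) (𝒜 : Finset (Finset α))
    (h𝒜 : ∅ ∉ 𝒜) (K : ℕ) (hK : 0 < K) :
    ∃ G ⊆ E, (∀ F ∈ 𝒜, ¬ F ⊆ G) ∧
      (E.card : ℝ) / K - ∑ F ∈ 𝒜, (1 / (K : ℝ)) ^ F.card ≤ G.card := by
  classical
  have : NeZero K := ⟨hK.ne'⟩
  have hK' : (0 : ℝ) < K := by exact_mod_cast hK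
  have hcount : ∀ F : Finset α,
      ((Finset.univ.filter fun ω : α → Fin K => ∀ e ∈ F, ω e = 0).card : ℝ)
        = (K : ℝ) ^ Fintype.card α * (1 / (K : ℝ)) ^ F.card := by
    intro F
    have h1 : (Finset.univ.filter fun ω : α → Fin K => ∀ e ∈ F, ω e = 0)
        = Fintype.piFinset fun e => if e ∈ F then {0} else Finset.univ := by
      ext ω
      simp only [Finset.mem_filter, Finset.mem_univ, true_and, Fintype.mem_piFinset]
      refine forall_congr' fun e => ?_
      by_cases he : e ∈ F <;> simp [he]
    rw [h1, Fintype.card_piFinset]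
    have h2 : ∀ e : α, (((if e ∈ F then ({0} : Finset (Fin K)) else Finset.univ).card : ℕ) : ℝ)
        = K * (if e ∈ F then 1 / (K : ℝ) else 1) := by
      intro e
      by_cases he : e ∈ F
      · simp [he, hK'.ne']
      · simp [he]
    push_cast
    rw [Finset.prod_congr rfl fun e _ => h2 e, Finset.prod_mul_distrib, Finset.prod_const,
      Finset.prod_ite_mem, Finset.univ_inter, Finset.prod_const, Finset.card_univ]
  set kept : (α → Fin K) → Finset α := fun ω => E.filter fun e => ω e = 0 with hkept
  have hsum : ∑ _ω : α → Fin K, ((E.card : ℝ) / K - ∑ F ∈ 𝒜, (1 / (K : ℝ)) ^ F.card)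
      ≤ ∑ ω : α → Fin K, (((kept ω).card : ℝ) - (𝒜.filter fun F => F ⊆ kept ω).card) := by
    rw [Finset.sum_sub_distrib (f := fun ω => ((kept ω).card : ℝ)), Finset.sum_const,
      Finset.card_univ, Fintype.card_fun,
      Fintype.card_fin, nsmul_eq_mul]
    push_cast
    rw [mul_sub]
    have hE : ∑ ω : α → Fin K, ((kept ω).card : ℝ) = (K : ℝ) ^ Fintype.card α * (E.card / K) := by
      simp only [hkept, Finset.card_filter, Nat.cast_sum]
      rw [Finset.sum_comm]
      have : ∀ e ∈ E, ∑ ω : α → Fin K, (((if ω e = 0 then 1 else 0 : ℕ)) : ℝ)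
          = (K : ℝ) ^ Fintype.card α * (1 / K) := by
        intro e _
        have := hcount {e}
        simp only [Finset.mem_singleton, forall_eq, Finset.card_singleton, pow_one] at this
        rw [← this, Finset.card_filter]
        push_cast
        rfl
      rw [Finset.sum_congr rfl this, Finset.sum_const, nsmul_eq_mul]
      ring
    have hB : ∑ ω : α → Fin K, ((𝒜.filter fun F => F ⊆ kept ω).card : ℝ)
        ≤ (K : ℝ) ^ Fintype.card α * ∑ F ∈ 𝒜, (1 / (K : ℝ)) ^ F.card := by
      simp only [Finset.card_filter, Nat.cast_sum]
      rw [Finset.sum_comm, Finset.mul_sum]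
      refine Finset.sum_le_sum fun F _ => ?_
      rw [← hcount F, Finset.card_filter]
      push_cast
      refine Finset.sum_le_sum fun ω _ => ?_
      by_cases h : F ⊆ kept ω
      · have : ∀ e ∈ F, ω e = 0 := fun e he => (Finset.mem_filter.1 (h he)).2
        rw [if_pos h, if_pos this]
      · simp only [h, if_false]
        split_ifs <;> simp
    rw [hE]
    linarith
  obtain ⟨ω, -, hω⟩ := Finset.exists_le_of_sum_le
    (Finset.univ_nonempty (α := α → Fin K)) hsum
  have hne : ∀ F ∈ 𝒜, F.Nonempty := fun F hF =>
    Finset.nonempty_iff_ne_empty.2 fun h => h𝒜 (h ▸ hF)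
  choose pick hpick using hne
  set D := (𝒜.filter fun F => F ⊆ kept ω).attach.image
    fun F => pick F.1 (Finset.mem_filter.1 F.2).1 with hD
  refine ⟨kept ω \ D, Finset.sdiff_subset.trans (Finset.filter_subset _ _), ?_, ?_⟩
  · intro F hF hsub
    have h1 := hsub (hpick F hF)
    exact (Finset.mem_sdiff.1 h1).2 (Finset.mem_image.2 ⟨⟨F, Finset.mem_filter.2
      ⟨hF, hsub.trans Finset.sdiff_subset⟩⟩, Finset.mem_attach _ _, rfl⟩)
  · refine hω.trans ?_
    have h1 : (kept ω).card ≤ (kept ω \ D).card + D.card := by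
      have := Finset.le_card_sdiff D (kept ω)
      omega
    have h2 : D.card ≤ (𝒜.filter fun F => F ⊆ kept ω).card :=
      Finset.card_image_le.trans_eq (Finset.card_attach)
    have h3 : ((kept ω).card : ℝ) ≤ (kept ω \ D).card + (𝒜.filter fun F => F ⊆ kept ω).card := by
      exact_mod_cast h1.trans (by omega)
    linarith

/-- The vertex set of the `D`-dimensional hypercube, as a vector space over `ZMod 2`. -/
abbrev Cube (D : ℕ) : Type := Fin D → ZMod 2

namespace Cube

variable {D : ℕ}

/-- The `i`-th standard basis vector of the hypercube. -/
def unit (i : Fin D) : Cube D := Pi.single i 1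

theorem add_self (x : Cube D) : x + x = 0 := by
  funext j
  exact CharTwo.add_self_eq_zero _

theorem add_unit_add_unit (x : Cube D) (i : Fin D) : x + unit i + unit i = x := by
  rw [add_assoc, add_self, add_zero]

theorem unit_apply_self (i : Fin D) : unit i i = 1 := by simp [unit]

theorem unit_apply_of_ne {i j : Fin D} (h : j ≠ i) : unit i j = 0 := by simp [unit, h]

theorem unit_injective : Function.Injective (unit : Fin D → Cube D) := by
  intro i j h
  by_contra hij
  have := congrFun h i
  rw [unit_apply_self, unit_apply_of_ne hij] at this
  exact one_ne_zero this

theorem add_unit_ne (x : Cube D) (i : Fin D) : x + unit i ≠ x := by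
  intro h
  have := congrFun (add_eq_left.1 h) i
  rw [unit_apply_self] at this
  exact one_ne_zero this

/-- The edges of the hypercube with both endpoints in `X`. -/
noncomputable def edgesIn (X : Finset (Cube D)) : Finset (Sym2 (Cube D)) :=
  ((X ×ˢ Finset.univ).filter fun p : Cube D × Fin D => p.1 + unit p.2 ∈ X).image
    fun p => s(p.1, p.1 + unit p.2)

theorem mem_edgesIn {X : Finset (Cube D)} {e : Sym2 (Cube D)} :
    e ∈ edgesIn X ↔ ∃ x ∈ X, ∃ i, x + unit i ∈ X ∧ e = s(x, x + unit i) := by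
  simp only [edgesIn, Finset.mem_image, Finset.mem_filter, Finset.mem_product, Finset.mem_univ,
    and_true, Prod.exists]
  constructor
  · rintro ⟨x, i, ⟨hx, hi⟩, rfl⟩
    exact ⟨x, hx, i, hi, rfl⟩
  · rintro ⟨x, hx, i, hi, rfl⟩
    exact ⟨x, i, ⟨hx, hi⟩, rfl⟩

theorem card_edgesIn_le (X : Finset (Cube D)) :
    ∀ k : ℕ, X.card ≤ 2 ^ k → (edgesIn X).card ≤ k * X.card := by
  induction hn : X.card using Nat.strong_induction_on generalizing X with
  | _ n ih =>
    subst hn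
    intro k hk
    by_cases hX : X.card ≤ 1
    · have : edgesIn X = ∅ := by
        refine Finset.eq_empty_of_forall_notMem fun e he => ?_
        obtain ⟨x, hx, i, hi, -⟩ := mem_edgesIn.1 he
        exact add_unit_ne x i (Finset.card_le_one.1 hX _ hi _ hx)
      simp [this]
    obtain ⟨x, hx, y, hy, hxy⟩ := Finset.one_lt_card.1 (not_le.1 hX)
    obtain ⟨i, hi⟩ := Function.ne_iff.1 hxy
    -- the two halves of `X` with respect to the `i`-th coordinate
    have key : ∀ P Q : Finset (Cube D), P ∪ Q = X → P.card + Q.card = X.card →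
        P.Nonempty → Q.Nonempty → P.card ≤ Q.card →
        (∀ a ∈ P, ∀ b ∈ Q, ∀ j, b = a + unit j → j = i) →
        (edgesIn X).card ≤ k * X.card := by
      intro P Q hPQ hc hP hQ hle hcross
      have hP' := hP.card_pos
      have hQ' := hQ.card_pos
      obtain ⟨k, rfl⟩ : ∃ l, k = l + 1 := by
        refine Nat.exists_eq_succ_of_ne_zero ?_
        rintro rfl
        simp at hk
        omega
      have h1 := ih P.card (by omega) P rfl k (by rw [pow_succ] at hk; omega)
      have h2 := ih Q.card (by omega) Q rfl (k + 1) (by omega)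
      have h3 : edgesIn X ⊆ edgesIn P ∪ edgesIn Q ∪ P.image fun a => s(a, a + unit i) := by
        intro e he
        obtain ⟨a, ha, j, haj, rfl⟩ := mem_edgesIn.1 he
        rw [← hPQ] at ha haj
        simp only [Finset.mem_union, mem_edgesIn, Finset.mem_image]
        rcases Finset.mem_union.1 ha with ha | ha <;> rcases Finset.mem_union.1 haj with haj | haj
        · exact Or.inl (Or.inl ⟨a, ha, j, haj, rfl⟩)
        · refine Or.inr ⟨a, ha, ?_⟩
          rw [hcross a ha _ haj j rfl]
        · refine Or.inr ⟨_, haj, ?_⟩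
          have := hcross _ haj a ha j (add_unit_add_unit a j).symm
          rw [← this, add_unit_add_unit, Sym2.eq_swap]
        · exact Or.inl (Or.inr ⟨a, ha, j, haj, rfl⟩)
      have h4 := (Finset.card_le_card h3).trans ((Finset.card_union_le _ _).trans
        (Nat.add_le_add (Finset.card_union_le _ _) Finset.card_image_le))
      rw [← hc]
      nlinarith
    have hcr : ∀ a b : Cube D, a i ≠ b i → ∀ j, b = a + unit j → j = i := by
      intro a b hab j hj
      by_contra hne
      refine hab ?_
      rw [hj, Pi.add_apply, unit_apply_of_ne (Ne.symm hne), add_zero]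
    set P := X.filter fun a => a i = x i
    set Q := X.filter fun a => ¬ a i = x i
    have hPQ : P ∪ Q = X := Finset.filter_union_filter_not_eq _ _
    have hc : P.card + Q.card = X.card := Finset.card_filter_add_card_filter_not _
    have hP : P.Nonempty := ⟨x, Finset.mem_filter.2 ⟨hx, rfl⟩⟩
    have hQ : Q.Nonempty := ⟨y, Finset.mem_filter.2 ⟨hy, Ne.symm hi⟩⟩
    have hne : ∀ a ∈ P, ∀ b ∈ Q, a i ≠ b i := by
      intro a ha b hb h
      exact (Finset.mem_filter.1 hb).2 (h ▸ (Finset.mem_filter.1 ha).2)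
    rcases le_total P.card Q.card with h | h
    · exact key P Q hPQ hc hP hQ h fun a ha b hb => hcr a b (hne a ha b hb)
    · exact key Q P (by rw [Finset.union_comm, hPQ]) (by omega) hQ hP h
        fun a ha b hb => hcr a b (hne b hb a ha).symm

/-- All pairs consisting of the vertex set and the edge set of a tree in the hypercube that is
rooted at the given vertex and whose shape is encoded by the given binary tree. -/
noncomputable def treeFamily :
    BinaryTree Unit → Cube D → Finset (Finset (Cube D) × Finset (Sym2 (Cube D)))
  | .nil, v => {({v}, ∅)}
  | .node _ l r, v => Finset.univ.biUnion fun i =>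
      (treeFamily l (v + unit i) ×ˢ treeFamily r v).image fun p =>
        (p.1.1 ∪ p.2.1, insert s(v, v + unit i) (p.1.2 ∪ p.2.2))

theorem mem_treeFamily_node {a : Unit} {l r : BinaryTree Unit} {v : Cube D}
    {p : Finset (Cube D) × Finset (Sym2 (Cube D))} :
    p ∈ treeFamily (.node a l r) v ↔ ∃ i, ∃ p₁ ∈ treeFamily l (v + unit i),
      ∃ p₂ ∈ treeFamily r v, p = (p₁.1 ∪ p₂.1, insert s(v, v + unit i) (p₁.2 ∪ p₂.2)) := by
  rw [treeFamily]
  simp only [Finset.mem_biUnion, Finset.mem_univ, true_and, Finset.mem_image, Finset.mem_product]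
  constructor
  · rintro ⟨i, ⟨p₁, p₂⟩, ⟨h₁, h₂⟩, rfl⟩
    exact ⟨i, p₁, h₁, p₂, h₂, rfl⟩
  · rintro ⟨i, p₁, h₁, p₂, h₂, rfl⟩
    exact ⟨i, (p₁, p₂), ⟨h₁, h₂⟩, rfl⟩

theorem card_treeFamily_le (t : BinaryTree Unit) (v : Cube D) :
    (treeFamily t v).card ≤ D ^ t.numNodes := by
  induction t generalizing v with
  | nil => simp [treeFamily, BinaryTree.numNodes]
  | node a l r ihl ihr =>
    rw [treeFamily, BinaryTree.numNodes]
    refine (Finset.card_biUnion_le_card_mul _ _ (D ^ l.numNodes * D ^ r.numNodes)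
      fun i _ => ?_).trans ?_
    · refine Finset.card_image_le.trans ?_
      rw [Finset.card_product]
      exact Nat.mul_le_mul (ihl _) (ihr _)
    · rw [Finset.card_univ, Fintype.card_fin]
      exact le_of_eq (by ring)

theorem card_fst_le_of_mem_treeFamily {t : BinaryTree Unit} {v : Cube D}
    {p : Finset (Cube D) × Finset (Sym2 (Cube D))} (hp : p ∈ treeFamily t v) :
    p.1.card ≤ t.numNodes + 1 := by
  induction t generalizing v p with
  | nil =>
    rw [treeFamily, Finset.mem_singleton] at hp
    simp [hp]
  | node a l r ihl ihr =>
    obtain ⟨i, p₁, h₁, p₂, h₂, rfl⟩ := mem_treeFamily_node.1 hp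
    have := ihl h₁
    have := ihr h₂
    have := Finset.card_union_le p₁.1 p₂.1
    simp only [BinaryTree.numNodes]
    omega

theorem exists_mem_treeFamily_insert {t : BinaryTree Unit} {v : Cube D}
    {p : Finset (Cube D) × Finset (Sym2 (Cube D))} (hp : p ∈ treeFamily t v) {a : Cube D}
    (ha : a ∈ p.1) (i : Fin D) :
    ∃ t' : BinaryTree Unit, t'.numNodes = t.numNodes + 1 ∧
      (insert (a + unit i) p.1, insert s(a, a + unit i) p.2) ∈ treeFamily t' v := by
  induction t generalizing v p with
  | nil =>
    rw [treeFamily, Finset.mem_singleton] at hp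
    subst hp
    obtain rfl := Finset.mem_singleton.1 ha
    refine ⟨.node () .nil .nil, rfl, mem_treeFamily_node.2 ⟨i, ({a + unit i}, ∅), ?_,
      ({a}, ∅), ?_, ?_⟩⟩
    · simp [treeFamily]
    · simp [treeFamily]
    · rfl
  | node b l r ihl ihr =>
    obtain ⟨j, p₁, h₁, p₂, h₂, rfl⟩ := mem_treeFamily_node.1 hp
    rcases Finset.mem_union.1 ha with ha | ha
    · obtain ⟨t', ht', h'⟩ := ihl h₁ ha
      refine ⟨.node b t' r, by simp only [BinaryTree.numNodes]; omega,
        mem_treeFamily_node.2 ⟨j, _, h', _, h₂, ?_⟩⟩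
      ext1
      · simp
      · simp [Finset.insert_comm]
    · obtain ⟨t', ht', h'⟩ := ihr h₂ ha
      refine ⟨.node b l t', by simp only [BinaryTree.numNodes]; omega,
        mem_treeFamily_node.2 ⟨j, _, h₁, _, h', ?_⟩⟩
      ext1
      · simp
      · simp [Finset.insert_comm]

/-- The edge sets consisting of a tree on `q` vertices containing `v` and `q + 1` further edges
spanned by its vertices. -/
noncomputable def denseFamily (v : Cube D) (q : ℕ) : Finset (Finset (Sym2 (Cube D))) :=
  ((BinaryTree.treesOfNumNodesEq (q - 1)).biUnion fun t => (treeFamily t v).biUnion fun p =>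
    ((edgesIn p.1).powersetCard (q + 1)).image fun J => p.2 ∪ J).filter fun F => F.card = 2 * q

theorem card_denseFamily_le (v : Cube D) {q k : ℕ} (hq : 1 ≤ q) (hk : q ≤ 2 ^ k) :
    (denseFamily v q).card ≤ (4 * D) ^ (q - 1) * (k * q).choose (q + 1) := by
  refine (Finset.card_filter_le _ _).trans ?_
  refine (Finset.card_biUnion_le_card_mul _ _ (D ^ (q - 1) * (k * q).choose (q + 1))
    fun t ht => ?_).trans ?_
  · rw [BinaryTree.mem_treesOfNumNodesEq] at ht
    refine (Finset.card_biUnion_le_card_mul _ _ ((k * q).choose (q + 1)) fun p hp => ?_).trans ?_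
    · refine Finset.card_image_le.trans ?_
      rw [Finset.card_powersetCard]
      have h1 : p.1.card ≤ q := (card_fst_le_of_mem_treeFamily hp).trans (by omega)
      exact Nat.choose_le_choose _ ((card_edgesIn_le p.1 k (h1.trans hk)).trans
        (Nat.mul_le_mul_left _ h1))
    · exact Nat.mul_le_mul_right _ (ht ▸ card_treeFamily_le t v)
  · rw [BinaryTree.treesOfNumNodesEq_card_eq_catalan, mul_pow, mul_assoc]
    refine Nat.mul_le_mul_right _ ?_
    rw [catalan_eq_centralBinom_div]
    exact (Nat.div_le_self _ _).trans (Nat.centralBinom_le_four_pow _)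

theorem exists_spanning_mem_treeFamily {H : SimpleGraph (Cube D)}
    (hH : ∀ x y, H.Adj x y → ∃ i, y = x + unit i) {X : Finset (Cube D)} {v : Cube D} (hv : v ∈ X)
    (hconn : ∀ S ⊆ X, v ∈ S → S ≠ X → ∃ a ∈ S, ∃ b ∈ X, b ∉ S ∧ H.Adj a b) :
    ∃ t : BinaryTree Unit, t.numNodes = X.card - 1 ∧ ∃ F, (X, F) ∈ treeFamily t v ∧
      F.card = X.card - 1 ∧ ∀ e ∈ F, e ∈ H.edgeSet := by
  have main : ∀ q, q + 1 ≤ X.card → ∃ t : BinaryTree Unit, t.numNodes = q ∧ ∃ V F,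
      (V, F) ∈ treeFamily t v ∧ V ⊆ X ∧ v ∈ V ∧ V.card = q + 1 ∧ F.card = q ∧
      (∀ e ∈ F, e ∈ H.edgeSet) ∧ ∀ e ∈ F, ∀ x ∈ e, x ∈ V := by
    intro q
    induction q with
    | zero =>
      intro _
      exact ⟨.nil, rfl, {v}, ∅, by simp [treeFamily], by simpa using hv, by simp⟩
    | succ q ih =>
      intro hq
      obtain ⟨t, ht, V, F, hVF, hVX, hvV, hV, hF, hFH, hFV⟩ := ih (by omega)
      obtain ⟨a, ha, b, hbX, hbV, hab⟩ := hconn V hVX hvV (by rintro rfl; omega)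
      obtain ⟨i, rfl⟩ := hH a b hab
      obtain ⟨t', ht', h'⟩ := exists_mem_treeFamily_insert hVF ha i
      refine ⟨t', by omega, _, _, h', ?_, ?_, ?_, ?_, ?_, ?_⟩
      · exact Finset.insert_subset hbX hVX
      · exact Finset.mem_insert_of_mem hvV
      · rw [Finset.card_insert_of_notMem hbV, hV]
      · rw [Finset.card_insert_of_notMem, hF]
        exact fun h => hbV (hFV _ h _ (Sym2.mem_mk_right _ _))
      · intro e he
        rcases Finset.mem_insert.1 he with rfl | he
        · exact hab
        · exact hFH e he
      · intro e he x hx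
        rcases Finset.mem_insert.1 he with rfl | he
        · rcases Sym2.mem_iff.1 hx with rfl | rfl
          · exact Finset.mem_insert_of_mem ha
          · exact Finset.mem_insert_self _ _
        · exact Finset.mem_insert_of_mem (hFV e he x hx)
  have hpos : 0 < X.card := Finset.card_pos.2 ⟨v, hv⟩
  obtain ⟨t, ht, V, F, hVF, hVX, -, hV, hF, hFH, -⟩ := main (X.card - 1) (by omega)
  obtain rfl := Finset.eq_of_subset_of_card_le hVX (by omega)
  exact ⟨t, ht, F, hVF, hF, hFH⟩

/-- A connected vertex set spanning at least twice as many edges as it has vertices contains a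
member of the dense family. -/
theorem exists_mem_denseFamily {H : SimpleGraph (Cube D)}
    (hH : ∀ x y, H.Adj x y → ∃ i, y = x + unit i) {X : Finset (Cube D)} {v : Cube D} (hv : v ∈ X)
    (hconn : ∀ S ⊆ X, v ∈ S → S ≠ X → ∃ a ∈ S, ∃ b ∈ X, b ∉ S ∧ H.Adj a b)
    {Y : Finset (Sym2 (Cube D))} (hYX : Y ⊆ edgesIn X) (hYH : ∀ e ∈ Y, e ∈ H.edgeSet)
    (hY : 2 * X.card ≤ Y.card) :
    ∃ F ∈ denseFamily v X.card, ∀ e ∈ F, e ∈ H.edgeSet := by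
  obtain ⟨t, ht, F, hF, hFc, hFH⟩ := exists_spanning_mem_treeFamily hH hv hconn
  have hpos : 0 < X.card := Finset.card_pos.2 ⟨v, hv⟩
  have hY' : X.card + 1 ≤ (Y \ F).card := by
    have := Finset.le_card_sdiff F Y
    omega
  obtain ⟨J, hJY, hJ⟩ := Finset.exists_subset_card_eq hY'
  have hJ' : ∀ e ∈ J, e ∈ Y ∧ e ∉ F := fun e he => Finset.mem_sdiff.1 (hJY he)
  refine ⟨F ∪ J, Finset.mem_filter.2 ⟨?_, ?_⟩, ?_⟩
  · refine Finset.mem_biUnion.2 ⟨t, BinaryTree.mem_treesOfNumNodesEq.2 ht, ?_⟩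
    refine Finset.mem_biUnion.2 ⟨_, hF, Finset.mem_image.2 ⟨J, ?_, rfl⟩⟩
    exact Finset.mem_powersetCard.2 ⟨fun e he => hYX (hJ' e he).1, hJ⟩
  · rw [Finset.card_union_of_disjoint, hFc, hJ]
    · omega
    · exact Finset.disjoint_left.2 fun e he he' => (hJ' e he').2 he
  · intro e he
    rcases Finset.mem_union.1 he with he | he
    · exact hFH e he
    · exact hYH e (hJ' e he).1

theorem mem_of_unit_add_sum_eq_zero {i : Fin D} {l : List (Fin D)}
    (h : unit i + (l.map unit).sum = 0) : i ∈ l := by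
  by_contra hi
  have h1 : ∀ l : List (Fin D), i ∉ l → (l.map unit).sum i = 0 := by
    intro l
    induction l with
    | nil => simp
    | cons j l ih =>
      intro hj
      rw [List.mem_cons, not_or] at hj
      rw [List.map_cons, List.sum_cons, Pi.add_apply, unit_apply_of_ne hj.1, ih hj.2, add_zero]
  have h2 := congrFun h i
  rw [Pi.add_apply, h1 l hi, unit_apply_self, add_zero] at h2
  exact one_ne_zero h2

theorem even_length_of_sum_eq_zero {l : List (Fin D)} (h : (l.map unit).sum = 0) :
    Even l.length := by
  have h1 : ∀ l : List (Fin D), ∑ j, (l.map unit).sum j = (l.length : ZMod 2) := by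
    intro l
    induction l with
    | nil => simp
    | cons i l ih =>
      simp only [List.map_cons, List.sum_cons, Pi.add_apply, Finset.sum_add_distrib, ih,
        List.length_cons, Nat.cast_add, Nat.cast_one]
      rw [add_comm]
      congr 1
      simp [unit]
  have h2 := h1 l
  rw [h] at h2
  simp only [Pi.zero_apply, Finset.sum_const_zero] at h2
  exact (ZMod.natCast_eq_zero_iff_even).1 h2.symm

/-- There are at most `(2kD)^k` closed sequences of `2k` directions in the hypercube. -/
theorem exists_finset_closed_lists (D k : ℕ) : ∃ Z : Finset (List (Fin D)),
    Z.card ≤ (2 * k * D) ^ k ∧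
      ∀ l : List (Fin D), l.length = 2 * k → (l.map unit).sum = 0 → l ∈ Z := by
  induction k with
  | zero =>
    refine ⟨{[]}, by simp, fun l hl _ => ?_⟩
    rw [Finset.mem_singleton]
    exact List.length_eq_zero_iff.1 hl
  | succ k ih =>
    obtain ⟨Z, hZ, hmem⟩ := ih
    refine ⟨((Finset.univ ×ˢ Finset.range (2 * k + 1)) ×ˢ Z).image
      (fun p : (Fin D × ℕ) × List (Fin D) =>
        p.1.1 :: (p.2.take p.1.2 ++ p.1.1 :: p.2.drop p.1.2)), ?_, ?_⟩
    · refine Finset.card_image_le.trans ?_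
      rw [Finset.card_product, Finset.card_product, Finset.card_univ, Fintype.card_fin,
        Finset.card_range, pow_succ']
      refine Nat.mul_le_mul ?_ (hZ.trans (Nat.pow_le_pow_left ?_ _)) <;> nlinarith
    · intro l hl hsum
      cases l with
      | nil => simp at hl
      | cons i l =>
        rw [List.map_cons, List.sum_cons] at hsum
        obtain ⟨l₁, l₂, rfl⟩ := List.append_of_mem (mem_of_unit_add_sum_eq_zero hsum)
        simp only [List.length_cons, List.length_append] at hl
        refine Finset.mem_image.2 ⟨((i, l₁.length), l₁ ++ l₂), ?_, by simp⟩
        simp only [Finset.mem_product, Finset.mem_univ, Finset.mem_range, true_and]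
        refine ⟨by omega, hmem _ (by simp only [List.length_append]; omega) ?_⟩
        simp only [List.map_append, List.sum_append, List.map_cons, List.sum_cons] at hsum ⊢
        calc (l₁.map unit).sum + (l₂.map unit).sum
            = (unit i + unit i) + ((l₁.map unit).sum + (l₂.map unit).sum) := by
              rw [add_self, zero_add]
          _ = 0 := by rw [← hsum]; abel

/-- The edges traversed by the walk that starts at `v` and follows the given directions. -/
def walkEdges : Cube D → List (Fin D) → List (Sym2 (Cube D))
  | _, [] => []
  | v, i :: l => s(v, v + unit i) :: walkEdges (v + unit i) l

theorem exists_list_of_walk {H : SimpleGraph (Cube D)}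
    (hH : ∀ x y, H.Adj x y → ∃ i, y = x + unit i) {v w : Cube D} (c : H.Walk v w) :
    ∃ l : List (Fin D), l.length = c.length ∧ w = v + (l.map unit).sum ∧
      c.edges = walkEdges v l := by
  induction c with
  | nil => exact ⟨[], rfl, by simp, rfl⟩
  | cons h c ih =>
    obtain ⟨l, hl, hw, he⟩ := ih
    obtain ⟨i, rfl⟩ := hH _ _ h
    refine ⟨i :: l, by simp [hl], ?_, ?_⟩
    · rw [hw, List.map_cons, List.sum_cons, add_assoc]
    · rw [SimpleGraph.Walk.edges_cons, he, walkEdges]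

theorem even_length_of_closed_walk {H : SimpleGraph (Cube D)}
    (hH : ∀ x y, H.Adj x y → ∃ i, y = x + unit i) {v : Cube D} (c : H.Walk v v) :
    Even c.length := by
  obtain ⟨l, hl, hw, -⟩ := exists_list_of_walk hH c
  rw [← hl]
  exact even_length_of_sum_eq_zero (left_eq_add.1 hw)

theorem exists_cycleFamily (v : Cube D) (k : ℕ) : ∃ 𝒞 : Finset (Finset (Sym2 (Cube D))),
    𝒞.card ≤ (2 * k * D) ^ k ∧ (∀ F ∈ 𝒞, F.card = 2 * k) ∧
      ∀ H : SimpleGraph (Cube D), (∀ x y, H.Adj x y → ∃ i, y = x + unit i) →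
        ∀ c : H.Walk v v, c.IsCycle → c.length = 2 * k → c.edges.toFinset ∈ 𝒞 := by
  obtain ⟨Z, hZ, hmem⟩ := exists_finset_closed_lists D k
  refine ⟨(Z.image fun l => (walkEdges v l).toFinset).filter fun F => F.card = 2 * k,
    (Finset.card_filter_le _ _).trans (Finset.card_image_le.trans hZ),
    fun F hF => (Finset.mem_filter.1 hF).2, ?_⟩
  intro H hH c hc hlen
  obtain ⟨l, hl, hw, he⟩ := exists_list_of_walk hH c
  refine Finset.mem_filter.2 ⟨Finset.mem_image.2 ⟨l, hmem l (by omega) ?_, by rw [he]⟩, ?_⟩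
  · exact left_eq_add.1 hw
  · rw [List.toFinset_card_of_nodup hc.edges_nodup, SimpleGraph.Walk.length_edges, hlen]

theorem mk_add_unit_injective (v : Cube D) :
    Function.Injective fun i : Fin D => s(v, v + unit i) := by
  intro i j h
  rcases Sym2.eq_iff.1 h with ⟨-, h⟩ | ⟨h, -⟩
  · exact unit_injective (add_left_cancel h)
  · exact absurd h.symm (add_unit_ne v j)

/-- The sets of `r` edges of the hypercube containing the vertex `v`. -/
noncomputable def starFamily (v : Cube D) (r : ℕ) : Finset (Finset (Sym2 (Cube D))) :=
  (Finset.powersetCard r Finset.univ).image fun I => I.image fun i => s(v, v + unit i)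

theorem card_starFamily_le (v : Cube D) (r : ℕ) : (starFamily v r).card ≤ D.choose r :=
  Finset.card_image_le.trans (by simp)

theorem card_of_mem_starFamily {v : Cube D} {r : ℕ} {F : Finset (Sym2 (Cube D))}
    (hF : F ∈ starFamily v r) : F.card = r := by
  obtain ⟨I, hI, rfl⟩ := Finset.mem_image.1 hF
  rw [Finset.card_image_of_injective _ (mk_add_unit_injective v)]
  exact (Finset.mem_powersetCard.1 hI).2

theorem exists_mem_starFamily {H : SimpleGraph (Cube D)}
    (hH : ∀ x y, H.Adj x y → ∃ i, y = x + unit i) {v : Cube D} {r : ℕ} {N : Finset (Cube D)}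
    (hN : ∀ y ∈ N, H.Adj v y) (hr : r ≤ N.card) :
    ∃ F ∈ starFamily v r, ∀ e ∈ F, e ∈ H.edgeSet := by
  classical
  have hsub : N ⊆ (Finset.univ.filter fun i => H.Adj v (v + unit i)).image
      fun i => v + unit i := by
    intro y hy
    obtain ⟨i, rfl⟩ := hH _ _ (hN y hy)
    exact Finset.mem_image.2 ⟨i, Finset.mem_filter.2 ⟨Finset.mem_univ _, hN _ hy⟩, rfl⟩
  obtain ⟨I, hI, hIr⟩ := Finset.exists_subset_card_eq
    (hr.trans ((Finset.card_le_card hsub).trans Finset.card_image_le))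
  refine ⟨_, Finset.mem_image.2 ⟨I, Finset.mem_powersetCard.2 ⟨Finset.subset_univ _, hIr⟩, rfl⟩,
    ?_⟩
  intro e he
  obtain ⟨i, hi, rfl⟩ := Finset.mem_image.1 he
  exact (Finset.mem_filter.1 (hI hi)).2

end Cube

/-- The expected number of members of `𝒜` in a random set of density `p`. -/
noncomputable def familyWeight {α : Type*} (p : ℝ) (𝒜 : Finset (Finset α)) : ℝ :=
  ∑ F ∈ 𝒜, p ^ F.card

theorem familyWeight_union_le {α : Type*} [DecidableEq α] {p : ℝ} (hp : 0 ≤ p)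
    (𝒜 ℬ : Finset (Finset α)) :
    familyWeight p (𝒜 ∪ ℬ) ≤ familyWeight p 𝒜 + familyWeight p ℬ := by
  unfold familyWeight
  rw [← Finset.sum_union_inter]
  have : 0 ≤ ∑ F ∈ 𝒜 ∩ ℬ, p ^ F.card := Finset.sum_nonneg fun _ _ => by positivity
  linarith

theorem familyWeight_biUnion_le {α ι : Type*} [DecidableEq α] [DecidableEq ι] {p : ℝ}
    (hp : 0 ≤ p) (s : Finset ι)
    (f : ι → Finset (Finset α)) :
    familyWeight p (s.biUnion f) ≤ ∑ i ∈ s, familyWeight p (f i) := by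
  induction s using Finset.induction_on with
  | empty => simp [familyWeight]
  | insert a s ha ih =>
    rw [Finset.biUnion_insert, Finset.sum_insert ha]
    exact (familyWeight_union_le hp _ _).trans (by linarith)

theorem familyWeight_of_card_eq {α : Type*} (p : ℝ) {𝒜 : Finset (Finset α)} {c : ℕ}
    (h : ∀ F ∈ 𝒜, F.card = c) : familyWeight p 𝒜 = 𝒜.card * p ^ c := by
  unfold familyWeight
  rw [Finset.sum_congr rfl fun F hF => by rw [h F hF], Finset.sum_const, nsmul_eq_mul]

theorem sum_half_pow_le_one (N : ℕ) : ∑ k ∈ Finset.Icc 1 N, (1 / 2 : ℝ) ^ k ≤ 1 := by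
  have h : ∑ k ∈ Finset.Icc 1 N, (1 / 2 : ℝ) ^ k = 1 - (1 / 2) ^ N := by
    induction N with
    | zero => simp
    | succ N ih => rw [Finset.sum_Icc_succ_top (by omega), ih]; ring
  rw [h]
  have : (0 : ℝ) < (1 / 2) ^ N := by positivity
  linarith

theorem choose_mul_pow_le_of_mul_le {D r : ℕ} {p t : ℝ} (hp : 0 ≤ p) (h : D * p ≤ t) :
    (D.choose r : ℝ) * p ^ r ≤ t ^ r / r.factorial := by
  have h1 : (D.choose r : ℝ) ≤ (D : ℝ) ^ r / r.factorial := Nat.choose_le_pow_div r D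
  calc (D.choose r : ℝ) * p ^ r ≤ (D : ℝ) ^ r / r.factorial * p ^ r := by gcongr
    _ = (D * p) ^ r / r.factorial := by rw [mul_pow]; ring
    _ ≤ t ^ r / r.factorial := by gcongr

theorem choose_mul_succ_le (k q : ℕ) :
    ((k * q).choose (q + 1) : ℝ) ≤ (k : ℝ) ^ (q + 1) * Real.exp 1 ^ q := by
  have h1 : ((k * q).choose (q + 1) : ℝ) ≤ ((k * q : ℕ) : ℝ) ^ (q + 1) / (q + 1).factorial :=
    Nat.choose_le_pow_div _ _
  have h2 : (q : ℝ) ^ q / q.factorial ≤ Real.exp q :=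
    Real.pow_div_factorial_le_exp _ (Nat.cast_nonneg q) q
  have h3 : (q : ℝ) ^ (q + 1) / (q + 1).factorial ≤ (q : ℝ) ^ q / q.factorial := by
    rw [Nat.factorial_succ, div_le_div_iff₀ (by positivity) (by positivity)]
    push_cast
    have : 0 ≤ (q : ℝ) ^ q * q.factorial := by positivity
    rw [pow_succ]
    nlinarith
  calc ((k * q).choose (q + 1) : ℝ) ≤ ((k * q : ℕ) : ℝ) ^ (q + 1) / (q + 1).factorial := h1
    _ = (k : ℝ) ^ (q + 1) * ((q : ℝ) ^ (q + 1) / (q + 1).factorial) := by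
      push_cast; rw [mul_pow]; ring
    _ ≤ (k : ℝ) ^ (q + 1) * Real.exp q := by gcongr; exact h3.trans h2
    _ = (k : ℝ) ^ (q + 1) * Real.exp 1 ^ q := by
      rw [← Real.exp_nat_mul, mul_one]

namespace Cube

variable {D : ℕ}

theorem card_of_mem_denseFamily {v : Cube D} {q : ℕ} {F : Finset (Sym2 (Cube D))}
    (hF : F ∈ denseFamily v q) : F.card = 2 * q :=
  (Finset.mem_filter.1 hF).2

theorem familyWeight_starFamily_le (v : Cube D) {p : ℝ} (hp : 0 ≤ p) (h : D * p ≤ 11) :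
    familyWeight p (starFamily v 49) ≤ 1 / 100 := by
  rw [familyWeight_of_card_eq p (c := 49) fun F hF => card_of_mem_starFamily hF]
  have h1 : ((starFamily v 49).card : ℝ) ≤ D.choose 49 := by
    exact_mod_cast card_starFamily_le v 49
  calc ((starFamily v 49).card : ℝ) * p ^ 49 ≤ (D.choose 49 : ℝ) * p ^ 49 := by gcongr
    _ ≤ (11 : ℝ) ^ 49 / (Nat.factorial 49 : ℕ) := choose_mul_pow_le_of_mul_le hp h
    _ ≤ 1 / 100 := by norm_num [Nat.factorial]

theorem familyWeight_le_of_card_cycles {𝒞 : Finset (Finset (Sym2 (Cube D)))} {k g : ℕ}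
    (hcard : 𝒞.card ≤ (2 * k * D) ^ k) (hmem : ∀ F ∈ 𝒞, F.card = 2 * k) {p : ℝ} (hp : 0 ≤ p)
    (h : D * p ≤ 11) (hk : 1 ≤ k) (hkg : 2 * k ≤ g) (hg : 10 ^ 5 ≤ g) (hgD : g * g ≤ D) :
    familyWeight p 𝒞 ≤ 1 / 100 * (1 / 2) ^ k := by
  rw [familyWeight_of_card_eq p hmem]
  have hg' : (10 : ℝ) ^ 5 ≤ g := by exact_mod_cast hg
  have hgD' : (g : ℝ) * g ≤ D := by exact_mod_cast hgD
  have hkg' : 2 * (k : ℝ) ≤ g := by exact_mod_cast hkg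
  have hD : (0 : ℝ) < D := by nlinarith
  have h1 : (𝒞.card : ℝ) ≤ (2 * k * D) ^ k := by exact_mod_cast hcard
  have h2 : 2 * (k : ℝ) * D * p ^ 2 ≤ 1 / 200 := by
    have h3 : (D * p) ^ 2 ≤ 11 ^ 2 := by gcongr
    have h4 : (g : ℝ) * (D * p ^ 2) * 10 ^ 5 ≤ 121 := by
      have h5 : (g : ℝ) * 10 ^ 5 ≤ D := by nlinarith
      calc (g : ℝ) * (D * p ^ 2) * 10 ^ 5 = g * 10 ^ 5 * (D * p ^ 2) := by ring
        _ ≤ D * (D * p ^ 2) := by gcongr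
        _ = (D * p) ^ 2 := by ring
        _ ≤ 121 := by linarith
    have h6 : 2 * (k : ℝ) * (D * p ^ 2) ≤ g * (D * p ^ 2) := by gcongr
    linarith
  calc (𝒞.card : ℝ) * p ^ (2 * k) ≤ (2 * k * D) ^ k * p ^ (2 * k) := by gcongr
    _ = (2 * (k : ℝ) * D * p ^ 2) ^ k := by rw [pow_mul, ← mul_pow]
    _ ≤ (1 / 200) ^ k := by gcongr
    _ = (1 / 100) ^ k * (1 / 2) ^ k := by rw [← mul_pow]; norm_num
    _ ≤ 1 / 100 * (1 / 2) ^ k := by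
      gcongr
      exact pow_le_of_le_one (by norm_num) (by norm_num) (by omega)

theorem familyWeight_denseFamily_le (v : Cube D) {q k : ℕ} (hq : 1 ≤ q) (hqk : q ≤ 2 ^ k)
    {p : ℝ} (hp : 0 ≤ p) (h : D * p ≤ 11) (hD : 0 < D) (hk : 4600 * k ≤ D) :
    familyWeight p (denseFamily v q) ≤ 1 / 100 * (1 / 2) ^ q := by
  rw [familyWeight_of_card_eq p fun F hF => card_of_mem_denseFamily hF]
  have hD' : (0 : ℝ) < D := by exact_mod_cast hD
  have hk' : 4600 * (k : ℝ) ≤ D := by exact_mod_cast hk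
  have h1 : ((denseFamily v q).card : ℝ) ≤ (4 * D) ^ (q - 1) * (k * q).choose (q + 1) := by
    exact_mod_cast card_denseFamily_le v hq hqk
  have he : Real.exp 1 ≤ 3 := by linarith [Real.exp_one_lt_d9]
  have h2 : 4 * (D : ℝ) * k * 3 * p ^ 2 ≤ 1 / 2 := by
    have h3 : (D * p) ^ 2 ≤ 11 ^ 2 := by gcongr
    have h4 : 4600 * (k : ℝ) * (D * p ^ 2) ≤ D * (D * p ^ 2) := by gcongr
    nlinarith
  calc ((denseFamily v q).card : ℝ) * p ^ (2 * q)
      ≤ (4 * D) ^ (q - 1) * ((k : ℝ) ^ (q + 1) * 3 ^ q) * p ^ (2 * q) := by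
        gcongr
        refine h1.trans ?_
        gcongr
        refine (choose_mul_succ_le k q).trans ?_
        gcongr
    _ = k / (4 * D) * (4 * (D : ℝ) * k * 3 * p ^ 2) ^ q := by
        obtain ⟨q, rfl⟩ : ∃ r, q = r + 1 := ⟨q - 1, by omega⟩
        simp only [Nat.add_sub_cancel, mul_pow, pow_mul]
        field_simp
        ring
    _ ≤ 1 / 100 * (1 / 2) ^ q := by
        have h3 : (k : ℝ) / (4 * D) ≤ 1 / 100 := by
          rw [div_le_div_iff₀ (by positivity) (by norm_num)]
          linarith
        gcongr

/-- A subset of the hypercube inducing many edges carries a sparse subgraph of average degree at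
least `8` with bounded degrees, large girth, and no small dense connected subgraph. -/
theorem exists_sparse_subgraph (X : Finset (Cube D)) {K k g : ℕ}
    (hX : ((D : ℝ) - 3) * X.card ≤ 2 * (edgesIn X).card) (hKD : 10 * K ≤ D) (hDK : D ≤ 11 * K)
    (hk : 4600 * k ≤ D) (hg : 10 ^ 5 ≤ g) (hgD : g * g ≤ D) :
    ∃ H : SimpleGraph (Cube D), ∃ G : Finset (Sym2 (Cube D)), H.edgeSet = G ∧ G ⊆ edgesIn X ∧
      4 * X.card ≤ G.card ∧ (∀ v (N : Finset (Cube D)), (∀ y ∈ N, H.Adj v y) → N.card ≤ 48) ∧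
      (∀ v (c : H.Walk v v), c.IsCycle → g < c.length) ∧
      ∀ v ∈ X, ∀ q, 1 ≤ q → q ≤ 2 ^ k → ∀ F ∈ denseFamily v q, ¬ ∀ e ∈ F, e ∈ H.edgeSet := by
  classical
  have hD : 0 < D := by nlinarith
  have hK : 0 < K := by omega
  have hK' : (0 : ℝ) < K := by exact_mod_cast hK
  set p : ℝ := 1 / K with hpdef
  have hp : 0 ≤ p := by positivity
  have hDp : D * p ≤ 11 := by
    rw [hpdef, mul_one_div, div_le_iff₀ hK']
    exact_mod_cast hDK
  choose 𝒞 h𝒞 h𝒞' h𝒞'' using fun v : Cube D => exists_cycleFamily v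
  let ℬ : Cube D → Finset (Finset (Sym2 (Cube D))) := fun v =>
    starFamily v 49 ∪ ((Finset.Icc 1 (g / 2)).biUnion (𝒞 v) ∪
      (Finset.Icc 1 (2 ^ k)).biUnion (denseFamily v))
  have hℬ : ∀ v, familyWeight p (ℬ v) ≤ 3 / 100 := by
    intro v
    have h1 := familyWeight_starFamily_le v hp hDp
    have h2 : familyWeight p ((Finset.Icc 1 (g / 2)).biUnion (𝒞 v)) ≤ 1 / 100 := by
      refine (familyWeight_biUnion_le hp _ _).trans ?_
      refine (Finset.sum_le_sum fun j hj => familyWeight_le_of_card_cycles (h𝒞 v j) (h𝒞' v j) hp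
        hDp (Finset.mem_Icc.1 hj).1 (g := g) ?_ hg hgD).trans ?_
      · have := (Finset.mem_Icc.1 hj).2
        omega
      · rw [← Finset.mul_sum]
        linarith [sum_half_pow_le_one (g / 2)]
    have h3 : familyWeight p ((Finset.Icc 1 (2 ^ k)).biUnion (denseFamily v)) ≤ 1 / 100 := by
      refine (familyWeight_biUnion_le hp _ _).trans ?_
      refine (Finset.sum_le_sum fun j hj => familyWeight_denseFamily_le v
        (Finset.mem_Icc.1 hj).1 (Finset.mem_Icc.1 hj).2 hp hDp hD hk).trans ?_
      rw [← Finset.mul_sum]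
      linarith [sum_half_pow_le_one (2 ^ k)]
    have h4 := familyWeight_union_le hp (starFamily v 49)
      ((Finset.Icc 1 (g / 2)).biUnion (𝒞 v) ∪ (Finset.Icc 1 (2 ^ k)).biUnion (denseFamily v))
    have h5 := familyWeight_union_le hp ((Finset.Icc 1 (g / 2)).biUnion (𝒞 v))
      ((Finset.Icc 1 (2 ^ k)).biUnion (denseFamily v))
    simp only [ℬ]
    linarith
  have hweight : familyWeight p (X.biUnion ℬ) ≤ 3 / 100 * X.card := by
    refine (familyWeight_biUnion_le hp _ _).trans ?_
    refine (Finset.sum_le_sum fun v _ => hℬ v).trans ?_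
    rw [Finset.sum_const, nsmul_eq_mul, mul_comm]
  have hempty : ∅ ∉ X.biUnion ℬ := by
    simp only [ℬ, Finset.mem_biUnion, Finset.mem_union, not_exists, not_and, not_or]
    intro v _
    refine ⟨fun h => ?_, fun j hj h => ?_, fun j hj h => ?_⟩
    · simpa using card_of_mem_starFamily h
    · have := h𝒞' v j _ h
      have := (Finset.mem_Icc.1 hj).1
      simp at *
      omega
    · have := card_of_mem_denseFamily h
      have := (Finset.mem_Icc.1 hj).1
      simp at *
      omega
  obtain ⟨G, hGE, hG, hcard⟩ := exists_subset_avoiding (edgesIn X) (X.biUnion ℬ) hempty K hK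
  have hset : (SimpleGraph.fromEdgeSet (G : Set (Sym2 (Cube D)))).edgeSet = G := by
    rw [SimpleGraph.edgeSet_fromEdgeSet, sdiff_eq_left]
    rw [Set.disjoint_left]
    intro e he hdiag
    obtain ⟨x, -, i, -, rfl⟩ := mem_edgesIn.1 (hGE he)
    exact add_unit_ne x i (Sym2.mk_isDiag_iff.1 hdiag).symm
  set H := SimpleGraph.fromEdgeSet (G : Set (Sym2 (Cube D))) with hHdef
  have hadjG : ∀ x y, H.Adj x y → s(x, y) ∈ G := by
    intro x y hxy
    have : s(x, y) ∈ H.edgeSet := hxy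
    rw [hset] at this
    exact this
  have hH : ∀ x y, H.Adj x y → x ∈ X ∧ ∃ i, y = x + unit i := by
    intro x y hxy
    obtain ⟨a, ha, i, hi, h⟩ := mem_edgesIn.1 (hGE (hadjG x y hxy))
    rcases Sym2.eq_iff.1 h with ⟨rfl, rfl⟩ | ⟨rfl, rfl⟩
    · exact ⟨ha, i, rfl⟩
    · exact ⟨hi, i, (add_unit_add_unit _ _).symm⟩
  have hbad : ∀ v ∈ X, ∀ F ∈ ℬ v, ¬ ∀ e ∈ F, e ∈ H.edgeSet := by
    intro v hv F hF hall
    refine hG F (Finset.mem_biUnion.2 ⟨v, hv, hF⟩) fun e he => ?_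
    have := hall e he
    rw [hset] at this
    exact this
  refine ⟨H, G, hset, hGE, ?_, ?_, ?_, ?_⟩
  · have h1 : ((10 * K : ℝ) - 3) * X.card ≤ 2 * (edgesIn X).card := by
      refine le_trans ?_ hX
      gcongr
      exact_mod_cast hKD
    have h2 : (4.85 : ℝ) * X.card ≤ (edgesIn X).card / K := by
      rw [le_div_iff₀ hK']
      have h10 : (10 : ℝ) ≤ K := by
        have : 10 ≤ K := by nlinarith
        exact_mod_cast this
      have h0 : (0 : ℝ) ≤ X.card := by positivity
      nlinarith
    have h3 : (4 : ℝ) * X.card ≤ G.card := by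
      have h0 : (0 : ℝ) ≤ X.card := by positivity
      unfold familyWeight at hweight
      linarith
    exact_mod_cast h3
  · intro v N hN
    by_contra hlt
    push Not at hlt
    have hv : v ∈ X := by
      obtain ⟨y, hy⟩ := Finset.card_pos.1 (by omega : 0 < N.card)
      exact (hH _ _ (hN y hy)).1
    obtain ⟨F, hF, hF'⟩ := exists_mem_starFamily (fun x y h => (hH x y h).2) hN
      (by omega : 49 ≤ N.card)
    exact hbad v hv F (Finset.mem_union_left _ hF) hF'
  · intro v c hc
    by_contra! hle
    obtain ⟨j, hj⟩ := even_length_of_closed_walk (fun x y h => (hH x y h).2) c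
    have h3 := hc.three_le_length
    have hv : v ∈ X := by
      cases c with
      | nil => simp at h3
      | cons h _ => exact (hH _ _ h).1
    refine hbad v hv c.edges.toFinset (Finset.mem_union_right _ (Finset.mem_union_left _
      (Finset.mem_biUnion.2 ⟨j, Finset.mem_Icc.2 ⟨by omega, by omega⟩,
        h𝒞'' v j H (fun x y h => (hH x y h).2) c hc (by omega)⟩))) ?_
    intro e he
    exact c.edges_subset_edgeSet (List.mem_toFinset.1 he)
  · intro v hv q hq hqk F hF
    exact hbad v hv F (Finset.mem_union_right _ (Finset.mem_union_right _
      (Finset.mem_biUnion.2 ⟨q, Finset.mem_Icc.2 ⟨hq, hqk⟩, hF⟩)))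

end Cube

namespace Cube

/-- The vertex of the hypercube given by the binary digits of a natural number. -/
def ofNat (D x : ℕ) : Cube D := fun i => if x.testBit i then 1 else 0

theorem ofNat_injOn {D x y : ℕ} (hx : x < 2 ^ D) (hy : y < 2 ^ D) (h : ofNat D x = ofNat D y) :
    x = y := by
  refine Nat.eq_of_testBit_eq fun i => ?_
  by_cases hi : i < D
  · have := congrFun h ⟨i, hi⟩
    simp only [ofNat] at this
    cases h1 : x.testBit i <;> cases h2 : y.testBit i <;> simp [h1, h2] at this ⊢
  · have hle : 2 ^ D ≤ 2 ^ i := Nat.pow_le_pow_right (by norm_num) (by omega)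
    rw [Nat.testBit_lt_two_pow (hx.trans_le hle), Nat.testBit_lt_two_pow (hy.trans_le hle)]

theorem ofNat_xor_two_pow {D x : ℕ} (i : Fin D) :
    ofNat D (x ^^^ 2 ^ (i : ℕ)) = ofNat D x + unit i := by
  funext j
  rw [Pi.add_apply]
  simp only [ofNat, Nat.testBit_xor, Nat.testBit_two_pow]
  by_cases hj : j = i
  · subst hj
    rw [unit_apply_self]
    cases x.testBit j <;> simp
    exact (CharTwo.add_self_eq_zero _).symm
  · have : ¬ (i : ℕ) = j := fun h => hj (Fin.ext h.symm)
    rw [unit_apply_of_ne hj]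
    simp [this]

/-- The first `n` vertices of the hypercube. -/
noncomputable def initialSegment (D n : ℕ) : Finset (Cube D) := (Finset.range n).image (ofNat D)

theorem card_initialSegment {D n : ℕ} (hn : n ≤ 2 ^ D) : (initialSegment D n).card = n := by
  rw [initialSegment, Finset.card_image_of_injOn, Finset.card_range]
  intro x hx y hy h
  exact ofNat_injOn ((Finset.mem_range.1 hx).trans_le hn) ((Finset.mem_range.1 hy).trans_le hn) h

theorem sum_le_card_edgesIn_initialSegment {D n : ℕ} (hn : n ≤ 2 ^ D) :
    ∑ i : Fin D, n / 2 ^ ((i : ℕ) + 1) * 2 ^ (i : ℕ) ≤ (edgesIn (initialSegment D n)).card := by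
  let P : Finset (Σ _ : Fin D, ℕ × ℕ) := Finset.univ.sigma fun i : Fin D =>
    Finset.range (n / 2 ^ ((i : ℕ) + 1)) ×ˢ Finset.range (2 ^ (i : ℕ))
  have hP : P.card = ∑ i : Fin D, n / 2 ^ ((i : ℕ) + 1) * 2 ^ (i : ℕ) := by
    simp [P, Finset.card_sigma]
  rw [← hP]
  let x : (Σ _ : Fin D, ℕ × ℕ) → ℕ := fun q => 2 ^ ((q.1 : ℕ) + 1) * q.2.1 + q.2.2
  have hmem : ∀ q ∈ P, q.2.1 < n / 2 ^ ((q.1 : ℕ) + 1) ∧ q.2.2 < 2 ^ (q.1 : ℕ) := by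
    intro q hq
    simpa [P] using hq
  have hdiv : ∀ q ∈ P, x q / 2 ^ ((q.1 : ℕ) + 1) = q.2.1 := by
    intro q hq
    have := (hmem q hq).2
    have hlt : q.2.2 < 2 ^ ((q.1 : ℕ) + 1) := by rw [pow_succ]; omega
    simp only [x]
    rw [Nat.mul_add_div (by positivity), Nat.div_eq_of_lt hlt, add_zero]
  have hlt_of_div : ∀ q ∈ P, ∀ y, y / 2 ^ ((q.1 : ℕ) + 1) = q.2.1 → y < n := by
    intro q hq y hy
    have h1 := (hmem q hq).1
    rw [← hy] at h1
    by_contra! hle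
    exact absurd (Nat.div_le_div_right hle) (not_le.2 h1)
  have hx : ∀ q ∈ P, x q < n := fun q hq => hlt_of_div q hq _ (hdiv q hq)
  have hy : ∀ q ∈ P, x q ^^^ 2 ^ (q.1 : ℕ) < n := by
    intro q hq
    refine hlt_of_div q hq _ ?_
    rw [← hdiv q hq, Nat.xor_div_two_pow, Nat.div_eq_of_lt (a := 2 ^ (q.1 : ℕ)), Nat.xor_zero]
    exact Nat.pow_lt_pow_right (by norm_num) (by omega)
  have hbit : ∀ q ∈ P, (ofNat D (x q)) q.1 = 0 := by
    intro q hq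
    have h2 := (hmem q hq).2
    have hlt : q.2.2 < 2 ^ ((q.1 : ℕ) + 1) := by rw [pow_succ]; omega
    simp only [ofNat, x]
    rw [Nat.testBit_two_pow_mul_add _ hlt, if_pos (by omega : (q.1 : ℕ) < q.1 + 1),
      Nat.testBit_lt_two_pow h2]
    simp
  refine Finset.card_le_card_of_injOn (fun q => s(ofNat D (x q), ofNat D (x q) + unit q.1)) ?_ ?_
  · intro q hq
    refine mem_edgesIn.2 ⟨_, Finset.mem_image_of_mem _ (Finset.mem_range.2 (hx q hq)), q.1, ?_, rfl⟩
    rw [← ofNat_xor_two_pow]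
    exact Finset.mem_image_of_mem _ (Finset.mem_range.2 (hy q hq))
  · intro q hq r hr h
    have hqr : q.1 = r.1 ∧ ofNat D (x q) = ofNat D (x r) := by
      rcases Sym2.eq_iff.1 h with ⟨h1, h2⟩ | ⟨h1, h2⟩
      · rw [h1] at h2
        exact ⟨unit_injective (add_left_cancel h2), h1⟩
      · exfalso
        rw [h1, add_assoc, add_eq_left] at h2
        have h3 : r.1 = q.1 :=
          unit_injective (add_right_cancel (h2.trans (add_self (unit q.1)).symm))
        have h4 := congrFun h1 q.1
        rw [Pi.add_apply, hbit q hq, h3, unit_apply_self, ← h3, hbit r hr, zero_add] at h4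
        exact zero_ne_one h4
    have hxx := ofNat_injOn ((hx q hq).trans_le hn) ((hx r hr).trans_le hn) hqr.2
    have hd1 := hdiv q hq
    have hd2 := hdiv r hr
    obtain ⟨i, a, b⟩ := q
    obtain ⟨j, a', b'⟩ := r
    obtain rfl : i = j := hqr.1
    simp only at hd1 hd2
    have ha : a = a' := by rw [← hd1, ← hd2, hxx]
    subst ha
    have hb : b = b' := by simpa [x] using hxx
    rw [hb]

theorem le_card_edgesIn_initialSegment {n : ℕ} (hn : n ≠ 0) :
    (((Nat.log 2 n + 1 : ℕ) : ℝ) - 3) * (initialSegment (Nat.log 2 n + 1) n).card ≤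
      2 * (edgesIn (initialSegment (Nat.log 2 n + 1) n)).card := by
  set d := Nat.log 2 n with hd
  have hlt : n < 2 ^ (d + 1) := Nat.lt_pow_succ_log_self (by norm_num) n
  have hge : 2 ^ d ≤ n := Nat.pow_log_le_self 2 hn
  rw [card_initialSegment hlt.le]
  have h1 := sum_le_card_edgesIn_initialSegment hlt.le
  rw [Fin.sum_univ_eq_sum_range (fun i => n / 2 ^ (i + 1) * 2 ^ i)] at h1
  have h2 : ∀ k : ℕ, k * n + 2 ≤ 2 * ∑ i ∈ Finset.range k, n / 2 ^ (i + 1) * 2 ^ i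
      + 2 * 2 ^ k := by
    intro k
    induction k with
    | zero => simp
    | succ k ih =>
      rw [Finset.sum_range_succ]
      have h3 := Nat.div_add_mod n (2 ^ (k + 1))
      have h4 := Nat.mod_lt n (show 2 ^ (k + 1) > 0 by positivity)
      generalize n / 2 ^ (k + 1) = t at *
      rw [pow_succ] at *
      nlinarith
  have h5 := h2 d
  have h6 : d * n ≤ 2 * (edgesIn (initialSegment (d + 1) n)).card + 2 * n := by
    rw [Finset.sum_range_succ] at h1
    have h7 : 0 ≤ n / 2 ^ (d + 1) * 2 ^ d := Nat.zero_le _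
    linarith
  have h7 : (d : ℝ) * n ≤ 2 * (edgesIn (initialSegment (d + 1) n)).card + 2 * n := by
    exact_mod_cast h6
  push_cast
  linarith

end Cube

open Classical in
theorem SimpleGraph.exists_connectedComponent_two_mul_card_le {V : Type*} [Fintype V]
    [Nonempty V] (G : SimpleGraph V) (h : 2 * Fintype.card V ≤ G.edgeFinset.card) :
    ∃ c : G.ConnectedComponent,
      2 * c.supp.toFinset.card ≤ (G.edgeFinset.filter fun e => ∀ v ∈ e, v ∈ c.supp).card := by
  by_contra! hlt
  have h1 : G.edgeFinset ⊆ (Finset.univ : Finset G.ConnectedComponent).biUnion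
      fun c => G.edgeFinset.filter fun e => ∀ v ∈ e, v ∈ c.supp := by
    intro e he
    induction e using Sym2.ind with
    | _ x y =>
      have hxy : G.Adj x y := by simpa using he
      refine Finset.mem_biUnion.2 ⟨G.connectedComponentMk x, Finset.mem_univ _,
        Finset.mem_filter.2 ⟨he, ?_⟩⟩
      intro v hv
      rcases Sym2.mem_iff.1 hv with rfl | rfl
      · rfl
      · exact ConnectedComponent.sound hxy.symm.reachable
  have h2 : ∑ c : G.ConnectedComponent, c.supp.toFinset.card = Fintype.card V := by
    rw [← Finset.card_univ, Finset.card_eq_sum_card_fiberwise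
      (f := G.connectedComponentMk) (t := Finset.univ) (by simp)]
    refine Finset.sum_congr rfl fun c _ => congrArg _ ?_
    ext v
    simp
  have h3 := (Finset.card_le_card h1).trans Finset.card_biUnion_le
  have h4 : ∑ c : G.ConnectedComponent, (G.edgeFinset.filter fun e => ∀ v ∈ e, v ∈ c.supp).card
      < ∑ c : G.ConnectedComponent, 2 * c.supp.toFinset.card :=
    Finset.sum_lt_sum_of_nonempty
      ⟨G.connectedComponentMk (Classical.arbitrary V), Finset.mem_univ _⟩ fun c _ => hlt c
  rw [← Finset.mul_sum, h2] at h4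
  omega

namespace Cube

theorem exists_connectedComponent_two_pow_lt {V : Type*} [Fintype V] [Nonempty V] {D k : ℕ}
    {H : SimpleGraph (Cube D)} (hH : ∀ x y, H.Adj x y → ∃ i, y = x + unit i) (ι : V ↪ Cube D)
    (hdense : ∀ v q, 1 ≤ q → q ≤ 2 ^ k → ∀ F ∈ denseFamily (ι v) q, ¬ ∀ e ∈ F, e ∈ H.edgeSet)
    {G : SimpleGraph V} (hG : G ≤ H.comap ι) (hcard : 2 * Fintype.card V ≤ G.edgeSet.ncard) :
    ∃ c : G.ConnectedComponent, 2 ^ k < c.supp.ncard := by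
  classical
  rw [Set.ncard_eq_toFinset_card', ← SimpleGraph.edgeFinset] at hcard
  obtain ⟨c, hc⟩ := G.exists_connectedComponent_two_mul_card_le (by convert hcard)
  refine ⟨c, ?_⟩
  by_contra! hle
  rw [Set.ncard_eq_toFinset_card'] at hle
  obtain ⟨v, rfl⟩ : ∃ v, G.connectedComponentMk v = c := c.exists_rep
  set C := (G.connectedComponentMk v).supp.toFinset with hC
  set E := G.edgeFinset.filter fun e => ∀ u ∈ e, u ∈ (G.connectedComponentMk v).supp with hE
  have hmem : ∀ u, u ∈ C ↔ G.Reachable u v := by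
    intro u
    simp [hC]
  have hvC : v ∈ C := (hmem v).2 (SimpleGraph.Reachable.refl v)
  have hCcard : (C.map ι).card = C.card := Finset.card_map ι
  have hle' : C.card ≤ 2 ^ k := by convert hle
  have hEcard : (E.map ι.sym2Map).card = E.card := Finset.card_map _
  have hadj : ∀ x y, (G.map ι).Adj x y → H.Adj x y := by
    intro x y hxy
    obtain ⟨a, b, hab, rfl, rfl⟩ := (SimpleGraph.map_adj ι G x y).1 hxy
    exact hG hab
  have key : ∃ F ∈ denseFamily (ι v) (C.map ι).card, ∀ e ∈ F, e ∈ (G.map ι).edgeSet := by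
    refine exists_mem_denseFamily (Y := E.map ι.sym2Map) (fun x y h => hH x y (hadj x y h))
      (Finset.mem_map_of_mem ι hvC) ?_ ?_ ?_ ?_
    · intro S hS hvS hne
      obtain ⟨b, hb, hbS⟩ : ∃ b ∈ C.map ι, b ∉ S := by
        by_contra! hall
        exact hne (Finset.Subset.antisymm hS hall)
      obtain ⟨u, hu, rfl⟩ := Finset.mem_map.1 hb
      obtain ⟨w⟩ := ((hmem u).1 hu).symm
      obtain ⟨d, hd, hd1, hd2⟩ := w.exists_boundary_dart {x | ι x ∈ S} hvS hbS
      refine ⟨ι d.fst, hd1, ι d.snd, Finset.mem_map_of_mem ι ?_, hd2, ?_⟩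
      · obtain ⟨a, ha, hae⟩ := Finset.mem_map.1 (hS hd1)
        rw [ι.injective hae, hmem] at ha
        exact (hmem _).2 (d.adj.symm.reachable.trans ha)
      · exact (SimpleGraph.map_adj ι G _ _).2 ⟨_, _, d.adj, rfl, rfl⟩
    · intro e he
      obtain ⟨e, he', rfl⟩ := Finset.mem_map.1 he
      obtain ⟨hG', hsupp⟩ := Finset.mem_filter.1 he'
      induction e using Sym2.ind with
      | _ x y =>
        have hxy : G.Adj x y := by simpa using hG'
        obtain ⟨i, hi⟩ := hH _ _ (hG hxy)
        have hx : ι x ∈ C.map ι := Finset.mem_map_of_mem ι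
          (Set.mem_toFinset.2 (hsupp x (Sym2.mem_mk_left x y)))
        have hy : ι y ∈ C.map ι := Finset.mem_map_of_mem ι
          (Set.mem_toFinset.2 (hsupp y (Sym2.mem_mk_right x y)))
        refine mem_edgesIn.2 ⟨ι x, hx, i, hi ▸ hy, ?_⟩
        rw [← hi]
        rfl
    · intro e he
      obtain ⟨e, he', rfl⟩ := Finset.mem_map.1 he
      have hG' := (Finset.mem_filter.1 he').1
      induction e using Sym2.ind with
      | _ x y =>
        have hxy : G.Adj x y := by simpa using hG'
        exact (SimpleGraph.map_adj ι G _ _).2 ⟨x, y, hxy, rfl, rfl⟩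
    · rw [hCcard, hEcard]
      convert hc
  obtain ⟨F, hF, hFH⟩ := key
  rw [hCcard] at hF
  refine hdense v C.card (Finset.card_pos.2 ⟨v, hvC⟩) hle' F hF fun e he => ?_
  have h1 := hFH e he
  revert h1
  induction e using Sym2.ind with
  | _ x y => exact hadj x y

end Cube

namespace SimpleGraph

variable {W : Type*}

/-- Every nonempty subset `T` of `S` has a vertex with at most one neighbour in `T`. -/
def IsOneDegenerateOn (G : SimpleGraph W) (S : Finset W) : Prop :=
  ∀ T ⊆ S, T.Nonempty → ∃ x ∈ T, ∀ y ∈ T, ∀ z ∈ T, G.Adj x y → G.Adj x z → y = z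

/-- The subgraph of `G` induced by `S` has an edge separator with at most `c` edges. -/
def HasSeparator [DecidableEq W] (G : SimpleGraph W) (S : Finset W) (c : ℕ) : Prop :=
  ∃ A ⊆ S, 3 * A.card ≤ 2 * S.card ∧ 3 * (S \ A).card ≤ 2 * S.card ∧
    ∃ P : Finset (W × W), P.card ≤ c ∧ ∀ a ∈ A, ∀ b ∈ S, b ∉ A → G.Adj a b → (a, b) ∈ P

/-- Every vertex of `G` has at most `d` neighbours. -/
def DegreesLE (G : SimpleGraph W) (d : ℕ) : Prop :=
  ∀ v (N : Finset W), (∀ y ∈ N, G.Adj v y) → N.card ≤ d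

theorem HasSeparator.of_le [DecidableEq W] {G G' : SimpleGraph W} {S : Finset W} {c d : ℕ}
    (h : G'.HasSeparator S c) {P : Finset (W × W)} (hP : P.card ≤ d)
    (hGP : ∀ a ∈ S, ∀ b ∈ S, G.Adj a b → ¬ G'.Adj a b → (a, b) ∈ P) :
    G.HasSeparator S (d + c) := by
  obtain ⟨A, hAS, h1, h2, Q, hQ, hcut⟩ := h
  refine ⟨A, hAS, h1, h2, P ∪ Q, (Finset.card_union_le _ _).trans (by omega), ?_⟩
  intro a ha b hb hbA hab
  rw [Finset.mem_union]
  by_cases h : G'.Adj a b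
  · exact Or.inr (hcut a ha b hb hbA h)
  · exact Or.inl (hGP a (hAS ha) b hb hab h)

theorem exists_neighbors_finset [Fintype W] {G : SimpleGraph W} {d : ℕ} (hd : G.DegreesLE d)
    (v : W) : ∃ N : Finset W, N.card ≤ d ∧ ∀ y, y ∈ N ↔ G.Adj v y := by
  classical
  refine ⟨Finset.univ.filter fun y => G.Adj v y, hd v _ fun y hy => (Finset.mem_filter.1 hy).2, ?_⟩
  simp

/-- Merging leaves into their neighbours until a balanced piece appears. -/
theorem hasSeparator_of_retraction [Fintype W] [DecidableEq W] {G : SimpleGraph W} {S : Finset W}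
    {d : ℕ} (hd : G.DegreesLE d) (hS : G.IsOneDegenerateOn S) (hne : S.Nonempty) (T : Finset W)
    (hTS : T ⊆ S) (f : W → W) (hfT : ∀ a ∈ S, f a ∈ T) (hf : ∀ a ∈ T, f a = a)
    (hcross : ∀ a ∈ S, ∀ b ∈ S, G.Adj a b → f a ≠ f b → f a = a ∧ f b = b)
    (hsmall : ∀ x ∈ T, 3 * (S.filter fun a => f a = x).card < S.card) :
    G.HasSeparator S d := by
  induction hn : T.card using Nat.strong_induction_on generalizing T f with
  | _ n ih =>
    subst hn
    have hTne : T.Nonempty := by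
      obtain ⟨a, ha⟩ := hne
      exact ⟨f a, hfT a ha⟩
    obtain ⟨x, hx, hxT⟩ := hS T hTS hTne
    obtain ⟨y, hy, hyx, hxy⟩ : ∃ y ∈ T, y ≠ x ∧ ∀ z ∈ T, G.Adj x z → z = y := by
      by_cases h : ∃ y ∈ T, G.Adj x y
      · obtain ⟨y, hy, hadj⟩ := h
        exact ⟨y, hy, hadj.ne', fun z hz hxz => hxT z hz y hy hxz hadj⟩
      · push Not at h
        obtain ⟨y, hy, hyx⟩ : ∃ y ∈ T, y ≠ x := by
          by_contra! hall
          have hfilter : (S.filter fun a => f a = x) = S :=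
            Finset.filter_true_of_mem fun a ha => hall _ (hfT a ha)
          have := hsmall x hx
          rw [hfilter] at this
          omega
        exact ⟨y, hy, hyx, fun z hz hxz => absurd hxz (h z hz)⟩
    set f' : W → W := fun a => if f a = x then y else f a with hf'
    have hfiber : ∀ z, z ≠ y → z ≠ x →
        (S.filter fun a => f' a = z) = S.filter fun a => f a = z := by
      intro z hzy hzx
      refine Finset.filter_congr fun a _ => ?_
      simp only [hf']
      split_ifs with h
      · simp [h, hzy.symm, hzx.symm]
      · rfl
    have hfy : (S.filter fun a => f' a = y).card ≤
        (S.filter fun a => f a = x).card + (S.filter fun a => f a = y).card := by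
      rw [← Finset.card_union_of_disjoint]
      · refine Finset.card_le_card fun a ha => ?_
        obtain ⟨haS, ha⟩ := Finset.mem_filter.1 ha
        simp only [hf'] at ha
        rw [Finset.mem_union, Finset.mem_filter, Finset.mem_filter]
        by_cases h : f a = x
        · exact Or.inl ⟨haS, h⟩
        · rw [if_neg h] at ha
          exact Or.inr ⟨haS, ha⟩
      · refine Finset.disjoint_left.2 fun a h1 h2 => hyx ?_
        rw [← (Finset.mem_filter.1 h2).2, (Finset.mem_filter.1 h1).2]
    have hfT' : ∀ a ∈ S, f' a ∈ T.erase x := by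
      intro a ha
      simp only [hf']
      split_ifs with h
      · exact Finset.mem_erase.2 ⟨hyx, hy⟩
      · exact Finset.mem_erase.2 ⟨h, hfT a ha⟩
    have hfix' : ∀ a ∈ T.erase x, f' a = a := by
      intro a ha
      obtain ⟨hax, ha⟩ := Finset.mem_erase.1 ha
      simp only [hf', hf a ha, if_neg hax]
    have hcross' : ∀ a ∈ S, ∀ b ∈ S, G.Adj a b → f' a ≠ f' b → f' a = a ∧ f' b = b := by
      intro a ha b hb hab hne'
      have hne : f a ≠ f b := fun h => hne' (by simp only [hf', h])
      obtain ⟨hfa, hfb⟩ := hcross a ha b hb hab hne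
      have haT : a ∈ T := hfa ▸ hfT a ha
      have hbT : b ∈ T := hfb ▸ hfT b hb
      by_cases hax : a = x
      · exfalso
        subst hax
        have hby := hxy b hbT hab
        refine hne' ?_
        simp only [hf', hfa, if_true, hfb, if_neg hab.ne']
        exact hby.symm
      by_cases hbx : b = x
      · exfalso
        subst hbx
        have hby := hxy a haT hab.symm
        refine hne' ?_
        simp only [hf', hfb, if_true, hfa, if_neg hab.ne]
        exact hby
      exact ⟨hfix' a (Finset.mem_erase.2 ⟨hax, haT⟩), hfix' b (Finset.mem_erase.2 ⟨hbx, hbT⟩)⟩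
    have hwx := hsmall x hx
    have hwy := hsmall y hy
    by_cases hbig : 3 * (S.filter fun a => f' a = y).card < S.card
    · refine ih (T.erase x).card (Finset.card_lt_card (Finset.erase_ssubset hx)) (T.erase x)
        ((Finset.erase_subset _ _).trans hTS) f' hfT' hfix' hcross' ?_ rfl
      intro z hz
      obtain ⟨hzx, hz⟩ := Finset.mem_erase.1 hz
      by_cases hzy : z = y
      · rw [hzy]
        exact hbig
      · rw [hfiber z hzy hzx]
        exact hsmall z hz
    · obtain ⟨N, hN, hNy⟩ := exists_neighbors_finset hd y
      have hsub : (S.filter fun a => f' a = y) ⊆ S := Finset.filter_subset _ _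
      refine ⟨S.filter fun a => f' a = y, hsub, by omega, ?_, N.image fun b => (y, b),
        Finset.card_image_le.trans hN, ?_⟩
      · rw [Finset.card_sdiff_of_subset hsub]
        omega
      · intro a ha b hb hbA hab
        obtain ⟨haS, hay⟩ := Finset.mem_filter.1 ha
        have hby : f' b ≠ y := fun h => hbA (Finset.mem_filter.2 ⟨hb, h⟩)
        have := (hcross' a haS b hb hab (by rw [hay]; exact hby.symm)).1
        have hay' : a = y := by rw [← this, hay]
        subst hay'
        exact Finset.mem_image.2 ⟨b, (hNy b).2 hab, rfl⟩

theorem IsOneDegenerateOn.hasSeparator [Fintype W] [DecidableEq W] {G : SimpleGraph W}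
    {S : Finset W} {d : ℕ} (hd : G.DegreesLE d) (hS : G.IsOneDegenerateOn S)
    (h2 : 2 ≤ S.card) : G.HasSeparator S d := by
  have hne : S.Nonempty := Finset.card_pos.1 (by omega)
  by_cases h3 : S.card ≤ 3
  · obtain ⟨v, hv⟩ := hne
    obtain ⟨N, hN, hNv⟩ := exists_neighbors_finset hd v
    have hsub : {v} ⊆ S := Finset.singleton_subset_iff.2 hv
    refine ⟨{v}, hsub, by rw [Finset.card_singleton]; omega, ?_, N.image fun b => (v, b),
      Finset.card_image_le.trans hN, ?_⟩
    · rw [Finset.card_sdiff_of_subset hsub, Finset.card_singleton]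
      omega
    · intro a ha b _ _ hab
      obtain rfl := Finset.mem_singleton.1 ha
      exact Finset.mem_image.2 ⟨b, (hNv b).2 hab, rfl⟩
  · refine hasSeparator_of_retraction hd hS hne S subset_rfl id (fun a ha => ha) (fun a _ => rfl)
      (fun _ _ _ _ _ _ => ⟨rfl, rfl⟩) ?_
    intro x hx
    have : (S.filter fun a => id a = x).card ≤ 1 := by
      refine Finset.card_le_one.2 fun a ha b hb => ?_
      rw [(Finset.mem_filter.1 ha).2.symm.trans rfl] at *
      exact ((Finset.mem_filter.1 ha).2.trans (Finset.mem_filter.1 hb).2.symm)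
    omega

theorem exists_isCycle_of_paths_avoiding {G : SimpleGraph W} {x y z v : W} (hxy : G.Adj x y)
    (hxz : G.Adj x z) (hyz : y ≠ z) (p : G.Walk y v) (q : G.Walk z v) (hp : x ∉ p.support)
    (hq : x ∉ q.support) :
    ∃ c : G.Walk z z, c.IsCycle ∧ c.length ≤ p.length + q.length + 2 := by
  classical
  let w := (p.append q.reverse).bypass
  have hw : x ∉ w.support := by
    intro h
    have := (p.append q.reverse).support_bypass_subset_support h
    rw [Walk.mem_support_append_iff, Walk.support_reverse, List.mem_reverse] at this
    exact this.elim hp hq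
  have hlen : w.length ≤ p.length + q.length := by
    have := (p.append q.reverse).length_bypass_le_length
    rwa [Walk.length_append, Walk.length_reverse] at this
  refine ⟨Walk.cons hxz.symm (Walk.cons hxy w), ?_, ?_⟩
  · rw [Walk.cons_isCycle_iff]
    refine ⟨(Walk.cons_isPath_iff _ _).2 ⟨Walk.bypass_isPath _, hw⟩, ?_⟩
    rw [Walk.edges_cons, List.mem_cons, not_or]
    refine ⟨fun h => ?_, fun h => hw (w.snd_mem_support_of_mem_edges h)⟩
    rcases Sym2.eq_iff.1 h with ⟨h1, -⟩ | ⟨h1, -⟩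
    · exact hxz.ne h1.symm
    · exact hyz h1.symm
  · simp only [Walk.length_cons]
    omega

theorem isOneDegenerateOn_of_rank {G : SimpleGraph W} {B : Finset W} {v : W} {ρ : W → ℕ} {r g : ℕ}
    (hρ : ∀ u ∈ B, u = v ∨ ∃ u' ∈ B, G.Adj u u' ∧ ρ u' < ρ u) (hr : ∀ u ∈ B, ρ u ≤ r)
    (hg : ∀ v (c : G.Walk v v), c.IsCycle → g < c.length) (hrg : 2 * r + 2 ≤ g) :
    G.IsOneDegenerateOn B := by
  have hwalk : ∀ k, ∀ u ∈ B, ρ u = k →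
      ∃ p : G.Walk u v, p.length ≤ k ∧ ∀ w ∈ p.support, w = u ∨ ρ w < k := by
    intro k
    induction k using Nat.strong_induction_on with
    | _ k ih =>
      rintro u hu rfl
      rcases hρ u hu with rfl | ⟨u', hu', hadj, hlt⟩
      · exact ⟨Walk.nil, by simp, by simp⟩
      · obtain ⟨p, hp, hsupp⟩ := ih _ hlt u' hu' rfl
        refine ⟨Walk.cons hadj p, by rw [Walk.length_cons]; omega, ?_⟩
        intro w hw
        rw [Walk.support_cons, List.mem_cons] at hw
        rcases hw with rfl | hw
        · exact Or.inl rfl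
        · rcases hsupp w hw with rfl | h
          · exact Or.inr hlt
          · exact Or.inr (h.trans hlt)
  intro T hTB hT
  obtain ⟨x, hx, hmax⟩ := T.exists_max_image ρ hT
  refine ⟨x, hx, fun y hy z hz hxy hxz => ?_⟩
  by_contra hyz
  obtain ⟨p, hp, hps⟩ := hwalk _ y (hTB hy) rfl
  obtain ⟨q, hq, hqs⟩ := hwalk _ z (hTB hz) rfl
  have hxp : x ∉ p.support := fun h => (hps x h).elim hxy.ne fun h => (hmax y hy).not_gt h
  have hxq : x ∉ q.support := fun h => (hqs x h).elim hxz.ne fun h => (hmax z hz).not_gt h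
  obtain ⟨c, hc, hlen⟩ := exists_isCycle_of_paths_avoiding hxy hxz hyz p q hxp hxq
  have h1 := hg z c hc
  have h2 := hr y (hTB hy)
  have h3 := hr z (hTB hz)
  omega

/-- A vertex set with slowly growing balls contains a ball with few outgoing edges, and such balls
of small radius span forests when the girth is large. -/
theorem exists_oneDegenerate_ball [Fintype W] [DecidableEq W] {G : SimpleGraph W} {S : Finset W}
    {M R k d g : ℕ} (hd : G.DegreesLE d) (hg : ∀ v (c : G.Walk v v), c.IsCycle → g < c.length)
    (hRg : 2 * R ≤ g) (hS : S.Nonempty) (hSM : S.card ≤ M)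
    (hgrow : ∀ c : ℕ → ℕ, c 0 = 1 → (∀ r, c r ≤ M) → ∃ r < R, k * (c (r + 1) - c r) ≤ c r) :
    ∃ B ⊆ S, B.Nonempty ∧ G.IsOneDegenerateOn B ∧ ∃ P : Finset (W × W),
      k * P.card ≤ d * B.card ∧ ∀ a ∈ B, ∀ b ∈ S, b ∉ B → G.Adj a b → (a, b) ∈ P := by
  classical
  obtain ⟨v, hv⟩ := hS
  let B : ℕ → Finset W := fun r =>
    Nat.rec {v} (fun _ B => B ∪ S.filter fun b => ∃ a ∈ B, G.Adj a b) r
  have hB0 : B 0 = {v} := rfl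
  have hBs : ∀ r, B (r + 1) = B r ∪ S.filter fun b => ∃ a ∈ B r, G.Adj a b := fun r => rfl
  have hBS : ∀ r, B r ⊆ S := by
    intro r
    induction r with
    | zero => rw [hB0]; exact Finset.singleton_subset_iff.2 hv
    | succ r ih => rw [hBs]; exact Finset.union_subset ih (Finset.filter_subset _ _)
  have hmono : Monotone B := monotone_nat_of_le_succ fun r => by
    rw [hBs]; exact Finset.subset_union_left
  obtain ⟨r, hrR, hr⟩ := hgrow (fun r => (B r).card) (by simp [hB0])
    fun r => (Finset.card_le_card (hBS r)).trans hSM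
  refine ⟨B r, hBS r, ⟨v, hmono (Nat.zero_le r) (by rw [hB0]; exact Finset.mem_singleton_self v)⟩,
    ?_, ?_⟩
  · let ρ : W → ℕ := fun u => sInf {j | u ∈ B j}
    have hρ : ∀ u j, u ∈ B j → ρ u ≤ j := fun u j h => Nat.sInf_le h
    refine isOneDegenerateOn_of_rank (v := v) (ρ := ρ) (r := r) ?_ (fun u hu => hρ u r hu) hg
      (by omega)
    intro u hu
    have hfind : u ∈ B (ρ u) := Nat.sInf_mem (s := {j | u ∈ B j}) ⟨r, hu⟩
    rcases hj : ρ u with _ | j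
    · rw [hj, hB0] at hfind
      exact Or.inl (Finset.mem_singleton.1 hfind)
    · right
      have hjr : j + 1 ≤ r := hj ▸ hρ u r hu
      have hnot : u ∉ B j := fun h => absurd (hρ u j h) (by omega)
      rw [hj, hBs, Finset.mem_union] at hfind
      obtain ⟨-, a, ha, hadj⟩ := Finset.mem_filter.1 (hfind.resolve_left hnot)
      exact ⟨a, hmono (by omega : j ≤ r) ha, hadj.symm, Nat.lt_succ_of_le (hρ a j ha)⟩
  · choose N hN hNv using fun v => exists_neighbors_finset hd v
    refine ⟨(B (r + 1) \ B r).biUnion fun b => (N b).image fun a => (a, b), ?_, ?_⟩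
    · have h1 : ((B (r + 1) \ B r).biUnion fun b => (N b).image fun a => (a, b)).card ≤
          (B (r + 1) \ B r).card * d :=
        Finset.card_biUnion_le_card_mul _ _ _ fun b _ => Finset.card_image_le.trans (hN b)
      have h2 : (B (r + 1) \ B r).card = (B (r + 1)).card - (B r).card :=
        Finset.card_sdiff_of_subset (hmono (Nat.le_succ r))
      rw [h2] at h1
      calc _ ≤ k * (((B (r + 1)).card - (B r).card) * d) := Nat.mul_le_mul_left k h1
        _ = d * (k * ((B (r + 1)).card - (B r).card)) := by ring
        _ ≤ d * (B r).card := Nat.mul_le_mul_left d hr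
    · intro a ha b hb hbB hab
      refine Finset.mem_biUnion.2 ⟨b, Finset.mem_sdiff.2 ⟨?_, hbB⟩,
        Finset.mem_image.2 ⟨a, (hNv b a).2 hab.symm, rfl⟩⟩
      rw [hBs]
      exact Finset.mem_union_right _ (Finset.mem_filter.2 ⟨hb, a, ha, hab⟩)

theorem exists_oneDegenerate_subgraph [Fintype W] [DecidableEq W] {G : SimpleGraph W}
    {M R k d g : ℕ} (hd : G.DegreesLE d) (hg : ∀ v (c : G.Walk v v), c.IsCycle → g < c.length)
    (hRg : 2 * R ≤ g)
    (hgrow : ∀ c : ℕ → ℕ, c 0 = 1 → (∀ r, c r ≤ M) → ∃ r < R, k * (c (r + 1) - c r) ≤ c r)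
    (S : Finset W) (hSM : S.card ≤ M) :
    ∃ G' ≤ G, G'.IsOneDegenerateOn S ∧ ∃ P : Finset (W × W), k * P.card ≤ 2 * d * S.card ∧
      ∀ a ∈ S, ∀ b ∈ S, G.Adj a b → ¬ G'.Adj a b → (a, b) ∈ P := by
  induction hn : S.card using Nat.strong_induction_on generalizing S with
  | _ n ih =>
    subst hn
    rcases S.eq_empty_or_nonempty with rfl | hS
    · refine ⟨G, le_rfl, fun T hT hne => ?_, ∅, by simp, by simp⟩
      rw [Finset.subset_empty.1 hT] at hne
      simp at hne
    obtain ⟨B, hBS, hB, hB1, P, hP, hPB⟩ := exists_oneDegenerate_ball hd hg hRg hS hSM hgrow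
    have hcard := Finset.card_sdiff_add_card_eq_card hBS
    have hBpos := hB.card_pos
    obtain ⟨G'', hle, hdeg, Q, hQ, hQS⟩ := ih (S \ B).card (by omega) (S \ B) (by omega) rfl
    let G' : SimpleGraph W :=
      { Adj := fun a b => G.Adj a b ∧ ((a ∈ B ∧ b ∈ B) ∨ (a ∉ B ∧ b ∉ B ∧ G''.Adj a b))
        symm := ⟨fun a b h => ⟨h.1.symm, h.2.imp (fun h => ⟨h.2, h.1⟩)
          fun h => ⟨h.2.1, h.1, h.2.2.symm⟩⟩⟩
        loopless := ⟨fun a h => G.loopless.irrefl a h.1⟩ }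
    refine ⟨G', fun a b h => h.1, ?_, P ∪ P.image Prod.swap ∪ Q, ?_, ?_⟩
    · intro T hTS hT
      by_cases hTB : (T ∩ B).Nonempty
      · obtain ⟨x, hx, hx'⟩ := hB1 (T ∩ B) Finset.inter_subset_right hTB
        obtain ⟨hxT, hxB⟩ := Finset.mem_inter.1 hx
        refine ⟨x, hxT, fun y hy z hz hxy hxz => ?_⟩
        have hyB : y ∈ B := hxy.2.elim (fun h => h.2) fun h => absurd hxB h.1
        have hzB : z ∈ B := hxz.2.elim (fun h => h.2) fun h => absurd hxB h.1
        exact hx' y (Finset.mem_inter.2 ⟨hy, hyB⟩) z (Finset.mem_inter.2 ⟨hz, hzB⟩) hxy.1 hxz.1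
      · have hdisj : ∀ a ∈ T, a ∉ B := fun a ha haB =>
          hTB ⟨a, Finset.mem_inter.2 ⟨ha, haB⟩⟩
        obtain ⟨x, hx, hx'⟩ := hdeg T
          (fun a ha => Finset.mem_sdiff.2 ⟨hTS ha, hdisj a ha⟩) hT
        refine ⟨x, hx, fun y hy z hz hxy hxz => hx' y hy z hz ?_ ?_⟩
        · exact hxy.2.elim (fun h => absurd h.1 (hdisj x hx)) fun h => h.2.2
        · exact hxz.2.elim (fun h => absurd h.1 (hdisj x hx)) fun h => h.2.2
    · have h1 : (P ∪ P.image Prod.swap ∪ Q).card ≤ P.card + P.card + Q.card := by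
        refine (Finset.card_union_le _ _).trans (Nat.add_le_add_right ?_ _)
        exact (Finset.card_union_le _ _).trans (Nat.add_le_add_left Finset.card_image_le _)
      calc _ ≤ k * (P.card + P.card + Q.card) := Nat.mul_le_mul_left k h1
        _ = 2 * (k * P.card) + k * Q.card := by ring
        _ ≤ 2 * (d * B.card) + 2 * d * (S \ B).card := by omega
        _ = 2 * d * S.card := by rw [← hcard]; ring
    · intro a ha b hb hab hnot
      rw [Finset.mem_union, Finset.mem_union]
      by_cases haB : a ∈ B
      · have hbB : b ∉ B := fun h => hnot ⟨hab, Or.inl ⟨haB, h⟩⟩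
        exact Or.inl (Or.inl (hPB a haB b hb hbB hab))
      · by_cases hbB : b ∈ B
        · exact Or.inl (Or.inr (Finset.mem_image.2 ⟨(b, a), hPB b hbB a ha haB hab.symm, rfl⟩))
        · refine Or.inr (hQS a (Finset.mem_sdiff.2 ⟨ha, haB⟩) b (Finset.mem_sdiff.2 ⟨hb, hbB⟩)
            hab fun h => hnot ⟨hab, Or.inr ⟨haB, hbB, h⟩⟩)

theorem hasSeparator_of_large_girth [Fintype W] [DecidableEq W] {G : SimpleGraph W}
    {d g : ℕ} (hd : G.DegreesLE d) (hg : ∀ v (c : G.Walk v v), c.IsCycle → g < c.length)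
    {S : Finset W} (hS : 2 ≤ S.card) (hSg : 2 * S.card ≤ g) :
    G.HasSeparator S d := by
  have hgrow : ∀ c : ℕ → ℕ, c 0 = 1 → (∀ r, c r ≤ S.card) →
      ∃ r < S.card, (2 * d * S.card + 1) * (c (r + 1) - c r) ≤ c r := by
    intro c h0 hc
    by_contra! hall
    have hlt : ∀ r ≤ S.card, r + 1 ≤ c r := by
      intro r
      induction r with
      | zero => omega
      | succ r ih =>
        intro hr
        have h1 := hall r (by omega)
        have h2 := ih (by omega)
        have h3 : c (r + 1) - c r ≠ 0 := by
          intro h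
          rw [h] at h1
          omega
        omega
    have := hlt S.card le_rfl
    have := hc S.card
    omega
  obtain ⟨G', hle, hdeg, P, hP, hPS⟩ := exists_oneDegenerate_subgraph (M := S.card)
    (R := S.card) (k := 2 * d * S.card + 1) hd hg hSg hgrow S le_rfl
  have hP0 : P.card ≤ 0 := by
    by_contra! h
    have := Nat.mul_le_mul_left (2 * d * S.card + 1) (show 1 ≤ P.card from h)
    omega
  rw [← zero_add d]
  exact HasSeparator.of_le (hdeg.hasSeparator (fun v N hN => hd v N fun y hy => hle (hN y hy)) hS)
    hP0 hPS

theorem hasSeparator_of_girth [Fintype W] [DecidableEq W] {G : SimpleGraph W}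
    {d g k : ℕ} (hd : G.DegreesLE d) (hg : ∀ v (c : G.Walk v v), c.IsCycle → g < c.length)
    {S : Finset W} (hS : 2 ≤ S.card) (hk : 0 < k) (hSk : S.card < 2 ^ k)
    (hkg : 2 * k ^ 2 ≤ g) :
    G.HasSeparator S (2 * d * S.card / k + d) := by
  have hgrow : ∀ c : ℕ → ℕ, c 0 = 1 → (∀ r, c r ≤ S.card) →
      ∃ r < k ^ 2, k * (c (r + 1) - c r) ≤ c r := by
    intro c h0 hc
    by_contra! hall
    have hk' : (0 : ℝ) < k := by exact_mod_cast hk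
    have hge : ∀ r ≤ k ^ 2, (1 + 1 / (k : ℝ)) ^ r ≤ c r := by
      intro r
      induction r with
      | zero => simp [h0]
      | succ r ih =>
        intro hr
        have h1 := hall r (by omega)
        have h2 := ih (by omega)
        have h3 : c r + k * c r ≤ k * c (r + 1) := by
          rcases le_total (c (r + 1)) (c r) with h | h
          · rw [Nat.sub_eq_zero_of_le h] at h1
            omega
          · obtain ⟨t, ht⟩ := Nat.exists_eq_add_of_le h
            rw [ht, Nat.add_sub_cancel_left] at h1
            rw [ht]
            nlinarith
        have h4 : (c r : ℝ) + k * c r ≤ k * c (r + 1) := by exact_mod_cast h3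
        calc (1 + 1 / (k : ℝ)) ^ (r + 1) = (1 + 1 / (k : ℝ)) ^ r * (1 + 1 / k) := pow_succ _ _
          _ ≤ c r * (1 + 1 / k) := by gcongr
          _ = (c r + k * c r) / k := by field_simp; ring
          _ ≤ c (r + 1) := by rw [div_le_iff₀ hk']; linarith
    have h1 := hge (k ^ 2) le_rfl
    have h2 : (2 : ℝ) ≤ (1 + 1 / (k : ℝ)) ^ k := by
      have hpos : 0 < 1 / (k : ℝ) := by positivity
      have := one_add_mul_le_pow (a := 1 / (k : ℝ)) (by linarith) k
      rw [mul_one_div_cancel hk'.ne'] at this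
      linarith
    have h3 : (2 : ℝ) ^ k ≤ (1 + 1 / (k : ℝ)) ^ (k ^ 2) := by
      rw [sq, pow_mul]
      gcongr
    have h4 : (2 : ℝ) ^ k ≤ c (k ^ 2) := h3.trans h1
    have h5 : 2 ^ k ≤ c (k ^ 2) := by exact_mod_cast h4
    have := hc (k ^ 2)
    omega
  obtain ⟨G', hle, hdeg, P, hP, hPS⟩ := exists_oneDegenerate_subgraph (M := S.card)
    (R := k ^ 2) (k := k) hd hg hkg hgrow S le_rfl
  refine HasSeparator.of_le
    (hdeg.hasSeparator (fun v N hN => hd v N fun y hy => hle (hN y hy)) hS) ?_ hPS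
  rw [Nat.le_div_iff_mul_le hk, mul_comm]
  exact hP

/-- Repeatedly removing at most half of the vertices along sparse cuts yields a separator. -/
theorem hasSeparator_of_sparse_cuts {W : Type*} [DecidableEq W] {G : SimpleGraph W} {S : Finset W}
    {c : ℝ} (hc : 0 ≤ c) (hstep : ∀ S' ⊆ S, 2 * S.card < 3 * S'.card → ∃ M ⊆ S', M.Nonempty ∧
      2 * M.card ≤ S'.card ∧ ∃ P : Finset (W × W), (P.card : ℝ) ≤ c * M.card ∧
        ∀ a ∈ M, ∀ b ∈ S', b ∉ M → G.Adj a b → (a, b) ∈ P) :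
    G.HasSeparator S ⌊c * S.card⌋₊ := by
  have key : ∀ S' ⊆ S, S.card ≤ 3 * S'.card → ∀ P : Finset (W × W),
      (P.card : ℝ) ≤ c * (S.card - S'.card) →
      (∀ a ∈ S', ∀ b ∈ S, b ∉ S' → G.Adj a b → (a, b) ∈ P) →
      G.HasSeparator S ⌊c * S.card⌋₊ := by
    intro S'
    induction hn : S'.card using Nat.strong_induction_on generalizing S' with
    | _ n ih =>
      subst hn
      intro hS' hge P hP hPS
      have hcard := Finset.card_sdiff_add_card_eq_card hS'
      by_cases hsmall : 3 * S'.card ≤ 2 * S.card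
      · refine ⟨S', hS', hsmall, by omega, P, Nat.le_floor (hP.trans ?_), hPS⟩
        gcongr
        have : (0 : ℝ) ≤ S'.card := by positivity
        linarith
      · obtain ⟨M, hM, hMne, hM2, Q, hQ, hQS⟩ := hstep S' hS' (by omega)
        have hMcard := Finset.card_sdiff_add_card_eq_card hM
        have hMpos := hMne.card_pos
        refine ih (S' \ M).card (by omega) (S' \ M) rfl (Finset.sdiff_subset.trans hS') (by omega)
          (P ∪ Q.image Prod.swap) ?_ ?_
        · have h1 : (P ∪ Q.image Prod.swap).card ≤ P.card + Q.card :=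
            (Finset.card_union_le _ _).trans (Nat.add_le_add_left Finset.card_image_le _)
          have h2 : ((P ∪ Q.image Prod.swap).card : ℝ) ≤ P.card + Q.card := by exact_mod_cast h1
          have h3 : ((S' \ M).card : ℝ) + M.card = S'.card := by exact_mod_cast hMcard
          rw [← h3] at hP
          linarith
        · intro a ha b hb hbn hab
          obtain ⟨haS, haM⟩ := Finset.mem_sdiff.1 ha
          rw [Finset.mem_union]
          by_cases hbS : b ∈ S'
          · have hbM : b ∈ M := by
              by_contra h
              exact hbn (Finset.mem_sdiff.2 ⟨hbS, h⟩)
            exact Or.inr (Finset.mem_image.2 ⟨(b, a), hQS b hbM a haS haM hab.symm, rfl⟩)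
          · exact Or.inl (hPS a haS b hb hbS hab)
  exact key S subset_rfl (by omega) ∅ (by simp) fun a _ b hb hbn _ => absurd hb hbn

end SimpleGraph

namespace Cube

variable {D : ℕ}

theorem add_unit_apply_of_ne_apply {x z : Cube D} {i : Fin D} (h : x i ≠ z i) :
    (x + unit i) i = z i := by
  have key : ∀ a b : ZMod 2, a ≠ b → a + 1 = b := by decide
  rw [Pi.add_apply, unit_apply_self]
  exact key _ _ h

theorem add_unit_apply_of_ne (x : Cube D) {i j : Fin D} (h : j ≠ i) : (x + unit i) j = x j := by
  rw [Pi.add_apply, unit_apply_of_ne h, add_zero]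

theorem card_hamming_ball_le (z : Cube D) (R : ℕ) :
    (Finset.univ.filter fun x : Cube D => hammingDist x z ≤ R).card ≤ (D + 1) ^ R := by
  induction R with
  | zero =>
    rw [pow_zero]
    refine Finset.card_le_one.2 fun a ha b hb => ?_
    rw [hammingDist_eq_zero.1 (Nat.le_zero.1 (Finset.mem_filter.1 ha).2),
      hammingDist_eq_zero.1 (Nat.le_zero.1 (Finset.mem_filter.1 hb).2)]
  | succ R ih =>
    let move : Cube D × Option (Fin D) → Cube D := fun q => q.2.elim q.1 fun i => q.1 + unit i
    have hsub : (Finset.univ.filter fun x : Cube D => hammingDist x z ≤ R + 1) ⊆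
        ((Finset.univ.filter fun x : Cube D => hammingDist x z ≤ R) ×ˢ Finset.univ).image move := by
      intro x hx
      have hx := (Finset.mem_filter.1 hx).2
      by_cases h : hammingDist x z ≤ R
      · exact Finset.mem_image.2 ⟨(x, none), Finset.mem_product.2
          ⟨Finset.mem_filter.2 ⟨Finset.mem_univ _, h⟩, Finset.mem_univ _⟩, rfl⟩
      · obtain ⟨i, hi⟩ : ∃ i, x i ≠ z i := by
          by_contra! hall
          rw [funext hall, hammingDist_self] at h
          omega
        refine Finset.mem_image.2 ⟨(x + unit i, some i), Finset.mem_product.2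
          ⟨Finset.mem_filter.2 ⟨Finset.mem_univ _, ?_⟩, Finset.mem_univ _⟩,
          add_unit_add_unit x i⟩
        have hlt : hammingDist (x + unit i) z < hammingDist x z := by
          refine Finset.card_lt_card ⟨fun j hj => ?_, fun hss => ?_⟩
          · have hj := (Finset.mem_filter.1 hj).2
            have hji : j ≠ i := by
              rintro rfl
              exact hj (add_unit_apply_of_ne_apply hi)
            rw [add_unit_apply_of_ne x hji] at hj
            exact Finset.mem_filter.2 ⟨Finset.mem_univ _, hj⟩
          · have := hss (Finset.mem_filter.2 ⟨Finset.mem_univ i, hi⟩)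
            exact (Finset.mem_filter.1 this).2 (add_unit_apply_of_ne_apply hi)
        exact Nat.le_of_lt_succ (hlt.trans_le hx)
    refine (Finset.card_le_card hsub).trans (Finset.card_image_le.trans ?_)
    rw [Finset.card_product, Finset.card_univ, Fintype.card_option, Fintype.card_fin, pow_succ]
    exact Nat.mul_le_mul_right _ ih

theorem exists_majority (S : Finset (Cube D)) :
    ∃ z : Cube D, ∀ i, 2 * (S.filter fun x => x i ≠ z i).card ≤ S.card := by
  have h : ∀ i, ∃ b : ZMod 2, 2 * (S.filter fun x => x i ≠ b).card ≤ S.card := by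
    intro i
    by_contra! hall
    have h0 := hall 0
    have h1 := hall 1
    have hdisj : Disjoint (S.filter fun x => x i ≠ 0) (S.filter fun x => x i ≠ 1) := by
      refine Finset.disjoint_left.2 fun x hx hx' => ?_
      have key : ∀ a : ZMod 2, a ≠ 0 → a ≠ 1 → False := by decide
      exact key _ (Finset.mem_filter.1 hx).2 (Finset.mem_filter.1 hx').2
    have hle := Finset.card_le_card (Finset.union_subset (Finset.filter_subset (fun x => x i ≠ 0) S)
      (Finset.filter_subset (fun x => x i ≠ 1) S))
    rw [Finset.card_union_of_disjoint hdisj] at hle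
    omega
  choose z hz using h
  exact ⟨z, hz⟩

/-- A large set of vertices has a coordinate along which a sparse subgraph of the hypercube is
cut by few edges, relative to the smaller side. -/
theorem exists_sparse_coordinate {H : SimpleGraph (Cube D)} {d R : ℕ} (hd : H.DegreesLE d)
    {S : Finset (Cube D)} {c : ℝ} (hcR : 2 * d ≤ c * R) (hc : 0 < c)
    (hS : 2 * (D + 1) ^ R < S.card) :
    ∃ (i : Fin D) (b : ZMod 2), (S.filter fun x => x i ≠ b).Nonempty ∧
      2 * (S.filter fun x => x i ≠ b).card ≤ S.card ∧
      ∃ N ⊆ S.filter fun x => x i ≠ b,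
        (N.card : ℝ) ≤ c * (S.filter fun x => x i ≠ b).card ∧
        ∀ x ∈ S, x i ≠ b → H.Adj x (x + unit i) → x ∈ N := by
  classical
  obtain ⟨z, hz⟩ := exists_majority S
  by_contra! hall
  let M : Fin D → Finset (Cube D) := fun i => S.filter fun x => x i ≠ z i
  let N : Fin D → Finset (Cube D) := fun i => (M i).filter fun x => H.Adj x (x + unit i)
  have h1 : ∀ i, c * (M i).card ≤ (N i).card := by
    intro i
    by_contra! hlt
    have hne : (M i).Nonempty := by
      rw [Finset.nonempty_iff_ne_empty]
      intro h
      rw [h] at hlt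
      simp at hlt
      have : (0 : ℝ) ≤ (N i).card := by positivity
      linarith
    obtain ⟨x, hxS, hx, hadj, hxN⟩ := hall i (z i) hne (hz i) (N i)
      (Finset.filter_subset _ _) hlt.le
    exact hxN (Finset.mem_filter.2 ⟨Finset.mem_filter.2 ⟨hxS, hx⟩, hadj⟩)
  have h2 : ∑ i, (N i).card ≤ d * S.card := by
    have hcount : ∑ i, (N i).card ≤ ∑ x ∈ S, (Finset.univ.filter fun i => x ∈ N i).card := by
      have hN : ∀ i, (N i).card = ∑ x ∈ S, if x ∈ N i then 1 else 0 := by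
        intro i
        rw [← Finset.card_filter]
        congr 1
        ext x
        simp only [N, M, Finset.mem_filter]
        tauto
      simp_rw [hN, Finset.card_filter]
      rw [Finset.sum_comm]
    refine hcount.trans ?_
    rw [mul_comm, ← smul_eq_mul]
    refine Finset.sum_le_card_nsmul _ _ _ fun x _ => ?_
    have := hd x ((Finset.univ.filter fun i => x ∈ N i).image fun i => x + unit i) (by
      intro y hy
      obtain ⟨i, hi, rfl⟩ := Finset.mem_image.1 hy
      exact (Finset.mem_filter.1 (Finset.mem_filter.1 hi).2).2)
    rwa [Finset.card_image_of_injective _ fun i j h => unit_injective (add_left_cancel h)] at this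
  have h3 : ∑ i, (M i).card = ∑ x ∈ S, hammingDist x z := by
    have hM : ∀ i, (M i).card = ∑ x ∈ S, if x i ≠ z i then 1 else 0 := fun i =>
      Finset.card_filter _ _
    simp_rw [hM]
    rw [Finset.sum_comm]
    refine Finset.sum_congr rfl fun x _ => ?_
    rw [hammingDist, Finset.card_filter]
  set F := S.filter fun x => ¬ hammingDist x z ≤ R with hF
  have h4 : R * F.card ≤ ∑ x ∈ S, hammingDist x z := by
    calc R * F.card = ∑ x ∈ F, R := by rw [Finset.sum_const, smul_eq_mul, mul_comm]
      _ ≤ ∑ x ∈ F, hammingDist x z :=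
        Finset.sum_le_sum fun x hx => (not_le.1 (Finset.mem_filter.1 hx).2).le
      _ ≤ ∑ x ∈ S, hammingDist x z :=
        Finset.sum_le_sum_of_subset (Finset.filter_subset _ _)
  have h5 : (S.filter fun x => hammingDist x z ≤ R).card ≤ (D + 1) ^ R :=
    (Finset.card_le_card (Finset.filter_subset_filter _ (Finset.subset_univ S))).trans
      (card_hamming_ball_le z R)
  have h6 : (S.filter fun x => hammingDist x z ≤ R).card + F.card = S.card := by
    convert Finset.card_filter_add_card_filter_not (s := S) (fun x => hammingDist x z ≤ R)
  have h7 : S.card < 2 * F.card := by omega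
  have h8 : c * (R * F.card) ≤ d * S.card := by
    have e1 : (R : ℝ) * F.card ≤ ∑ i, ((M i).card : ℝ) := by
      rw [← h3] at h4
      exact_mod_cast h4
    have e2 : ∑ i, ((N i).card : ℝ) ≤ d * S.card := by exact_mod_cast h2
    calc c * (R * F.card) ≤ c * ∑ i, ((M i).card : ℝ) := by gcongr
      _ = ∑ i, c * ((M i).card : ℝ) := Finset.mul_sum _ _ _
      _ ≤ ∑ i, ((N i).card : ℝ) := Finset.sum_le_sum fun i _ => h1 i
      _ ≤ d * S.card := e2
  have h9 : (S.card : ℝ) < 2 * F.card := by exact_mod_cast h7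
  have h10 : 2 * (d : ℝ) * F.card ≤ c * R * F.card := by gcongr
  rcases Nat.eq_zero_or_pos d with rfl | hdpos
  · have hMe : ∀ i, (M i).card = 0 := by
      intro i
      have e1 := Finset.single_le_sum (f := fun i => (N i).card) (fun i _ => Nat.zero_le _)
        (Finset.mem_univ i)
      have e2 : (N i).card = 0 := by omega
      have e3 := h1 i
      rw [e2] at e3
      have e4 : ((M i).card : ℝ) ≤ 0 := by
        by_contra! hpos
        have : 0 < c * ((M i).card : ℝ) := by positivity
        push_cast at e3
        linarith
      exact_mod_cast le_antisymm e4 (by positivity)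
    have e5 : ∑ x ∈ S, hammingDist x z = 0 := by
      rw [← h3]
      exact Finset.sum_eq_zero fun i _ => hMe i
    have e6 : F = ∅ := by
      refine Finset.filter_eq_empty_iff.2 fun x hx => ?_
      have := Finset.sum_eq_zero_iff.1 e5 x hx
      omega
    rw [e6] at h7
    simp at h7
  · have : (0 : ℝ) < d := by exact_mod_cast hdpos
    nlinarith

theorem hasSeparator_of_card_ge {H : SimpleGraph (Cube D)} {d R : ℕ} (hd : H.DegreesLE d)
    (hH : ∀ x y, H.Adj x y → ∃ i, y = x + unit i)
    {S : Finset (Cube D)} {c : ℝ} (hcR : 2 * d ≤ c * R) (hc : 0 < c)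
    (hS : 3 * (D + 1) ^ R ≤ S.card) : H.HasSeparator S ⌊c * S.card⌋₊ := by
  refine SimpleGraph.hasSeparator_of_sparse_cuts hc.le fun S' hS' hlt => ?_
  obtain ⟨i, b, hne, hhalf, N, hN, hNc, hNmem⟩ := exists_sparse_coordinate hd hcR hc
    (S := S') (by omega)
  refine ⟨_, Finset.filter_subset _ _, hne, hhalf, N.image fun x => (x, x + unit i), ?_, ?_⟩
  · refine le_trans ?_ hNc
    exact_mod_cast Finset.card_image_le
  · intro x hx y hy hyM hxy
    obtain ⟨hxS, hxb⟩ := Finset.mem_filter.1 hx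
    obtain ⟨j, rfl⟩ := hH x y hxy
    have hyb : (x + unit j) i = b := by
      by_contra h
      exact hyM (Finset.mem_filter.2 ⟨hy, h⟩)
    have hij : i = j := by
      by_contra h
      rw [add_unit_apply_of_ne x h] at hyb
      exact hxb hyb
    subst hij
    exact Finset.mem_image.2 ⟨x, hNmem x hxS hxb hxy, rfl⟩

end Cube

theorem ncard_setOf_mem_of_subset {V W : Type*} (ι : V ↪ W) {s : Set V} {S T : Finset W}
    (hS : ∀ w ∈ S, ∃ v ∈ s, ι v = w) (hT : T ⊆ S) :
    {x : s | ι x ∈ T}.ncard = T.card := by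
  rw [← Set.ncard_image_of_injective _ (ι.injective.comp Subtype.val_injective),
    ← Set.ncard_coe_finset]
  congr 1
  ext w
  constructor
  · rintro ⟨x, hx, rfl⟩
    exact hx
  · intro hw
    obtain ⟨v, hv, rfl⟩ := hS w (hT hw)
    exact ⟨⟨v, hv⟩, hw, rfl⟩

theorem sep_induce_comap_le {V W : Type*} [Finite V] [DecidableEq W] (ι : V ↪ W)
    (H : SimpleGraph W) {s : Set V} {S : Finset W} (hS : ∀ w, w ∈ S ↔ ∃ v ∈ s, ι v = w) {c : ℕ}
    (h : H.HasSeparator S c) : sep ((H.comap ι).induce s) ≤ c := by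
  obtain ⟨A, hAS, h1, h2, P, hP, hcut⟩ := h
  have hncard := fun T hT =>
    ncard_setOf_mem_of_subset ι (s := s) (S := S) (T := T) (fun w => (hS w).1) hT
  have hmem : ∀ x : s, ι x ∈ S := fun x => (hS _).2 ⟨x, x.2, rfl⟩
  have hcard : Nat.card s = S.card := by
    rw [← hncard S subset_rfl, ← Set.ncard_univ]
    congr 1
    ext x
    simp [hmem x]
  have hcompl : {x : s | ι x ∈ A}ᶜ.ncard = (S \ A).card := by
    rw [← hncard (S \ A) Finset.sdiff_subset]
    congr 1
    ext x
    simp [hmem x]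
  have hle : (cutEdges ((H.comap ι).induce s) {x : s | ι x ∈ A}).ncard ≤ c := by
    let Q : Set (s × s) := {q | ι q.1 ∈ A ∧ ι q.2 ∉ A ∧ H.Adj (ι q.1) (ι q.2)}
    have hsub : cutEdges ((H.comap ι).induce s) {x : s | ι x ∈ A} ⊆
        (fun q : s × s => s(q.1, q.2)) '' Q := by
      rintro e ⟨he, u, hu, v, hv, rfl⟩
      exact ⟨(u, v), ⟨hu, hv, he⟩, rfl⟩
    have hQ : Q.ncard ≤ (P : Set (W × W)).ncard := by
      refine Set.ncard_le_ncard_of_injOn (fun q => (ι q.1, ι q.2)) ?_ ?_ P.finite_toSet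
      · rintro ⟨u, v⟩ ⟨hu, hv, huv⟩
        exact hcut _ hu _ (hmem v) hv huv
      · rintro ⟨u, v⟩ - ⟨u', v'⟩ - h
        obtain ⟨h1, h2⟩ := Prod.mk.inj h
        exact Prod.ext (Subtype.ext (ι.injective h1)) (Subtype.ext (ι.injective h2))
    rw [Set.ncard_coe_finset] at hQ
    calc _ ≤ ((fun q : s × s => s(q.1, q.2)) '' Q).ncard := Set.ncard_le_ncard hsub (Set.toFinite _)
      _ ≤ Q.ncard := Set.ncard_image_le (Set.toFinite _)
      _ ≤ c := hQ.trans hP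
  refine le_trans (Nat.sInf_le ⟨{x : s | ι x ∈ A}, ?_, ?_, rfl⟩) hle
  · rw [hncard A hAS, hcard]
    exact h1
  · rw [hcompl, hcard]
    exact h2

theorem logb_two_natCast_pow (k : ℕ) : Real.logb 2 ((2 : ℝ) ^ k) = k := by
  rw [← Real.rpow_natCast, Real.logb_rpow (by norm_num) (by norm_num)]

theorem three_mul_pow_le_of_logb {D R m : ℕ} {l t : ℝ} (hl : Real.logb 2 m = l)
    (ht : Real.logb 2 l = t) (hm : 0 < m) (hl0 : 0 < l) (ht0 : 1294 ≤ t)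
    (hD : ((D + 1 : ℕ) : ℝ) ≤ 64 * l ^ 4) (hR : (R : ℝ) ≤ 96 * l / t ^ 2 + 1) :
    3 * (D + 1) ^ R ≤ m := by
  have hm' : (0 : ℝ) < m := by exact_mod_cast hm
  have hml : (m : ℝ) = 2 ^ l := by
    rw [← hl, Real.rpow_logb (by norm_num) (by norm_num) hm']
  have hlt : l = 2 ^ t := by
    rw [← ht, Real.rpow_logb (by norm_num) (by norm_num) hl0]
  have hD2 : ((D + 1 : ℕ) : ℝ) ≤ 2 ^ (6 + 4 * t) := by
    refine hD.trans (le_of_eq ?_)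
    rw [Real.rpow_add (by norm_num), mul_comm 4 t, Real.rpow_mul (by norm_num), ← hlt]
    norm_num
  have hbig : 200 * t ≤ l := by
    have h1 : l = Real.exp (Real.log 2 * t) := by
      rw [hlt, Real.rpow_def_of_pos (by norm_num)]
    have h2 := Real.log_two_gt_d9
    have h3 : (0.69 : ℝ) * t ≤ Real.log 2 * t := by
      gcongr
      linarith
    have h4 := Real.quadratic_le_exp_of_nonneg (x := Real.log 2 * t) (by nlinarith)
    rw [← h1] at h4
    nlinarith
  have hexp : 2 + (6 + 4 * t) * R ≤ l := by
    have h1 : (6 + 4 * t) * R ≤ 5 * t * (96 * l / t ^ 2 + 1) := by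
      gcongr
      linarith
    have h2 : 5 * t * (96 * l / t ^ 2 + 1) = 480 * l / t + 5 * t := by
      field_simp
      ring
    have h3 : 480 * l / t ≤ l / 2 := by
      rw [div_le_div_iff₀ (by linarith) (by norm_num)]
      nlinarith
    linarith
  have hfinal : (3 : ℝ) * ((D + 1 : ℕ) : ℝ) ^ R ≤ m := by
    calc (3 : ℝ) * ((D + 1 : ℕ) : ℝ) ^ R ≤ 2 ^ (2 : ℝ) * (2 ^ (6 + 4 * t)) ^ R := by
          gcongr
          norm_num
      _ = 2 ^ (2 + (6 + 4 * t) * R) := by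
          rw [← Real.rpow_natCast, ← Real.rpow_mul (by norm_num), ← Real.rpow_add (by norm_num)]
      _ ≤ 2 ^ l := Real.rpow_le_rpow_of_exponent_le (by norm_num) hexp
      _ = m := hml.symm
  exact_mod_cast hfinal

namespace Cube

theorem exists_hasSeparator {D g : ℕ} {H : SimpleGraph (Cube D)} (hd : H.DegreesLE 48)
    (hH : ∀ x y, H.Adj x y → ∃ i, y = x + unit i)
    (hg : ∀ v (c : H.Walk v v), c.IsCycle → g < c.length) (hDg : D < (g + 1) * (g + 1))
    (hD : 5184 ≤ Real.logb 2 D) {S : Finset (Cube D)} (hS : 2 ≤ S.card) :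
    ∃ c : ℕ, H.HasSeparator S c ∧ (c : ℝ) ≤
      (S.card : ℝ) / Real.logb 2 S.card * Real.logb 2 (Real.logb 2 S.card) ^ 2 + 48 := by
  set m := S.card with hm
  have hm2 : (2 : ℝ) ≤ m := by exact_mod_cast hS
  obtain ⟨l, hl⟩ : ∃ l, Real.logb 2 m = l := ⟨_, rfl⟩
  obtain ⟨t, ht⟩ : ∃ t, Real.logb 2 l = t := ⟨_, rfl⟩
  rw [hl, ht]
  have hl1 : 1 ≤ l := by
    rw [← hl, Real.le_logb_iff_rpow_le (by norm_num) (by linarith)]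
    simpa using hm2
  have hDpos : (0 : ℝ) < D := by
    rcases Nat.eq_zero_or_pos D with rfl | h
    · norm_num at hD
    · exact_mod_cast h
  have hDg' : (D : ℝ) < (g + 1) ^ 2 := by rw [sq]; exact_mod_cast hDg
  have hglog : 2592 ≤ Real.logb 2 ((g : ℝ) + 1) := by
    have h1 : Real.logb 2 D ≤ Real.logb 2 (((g : ℝ) + 1) ^ 2) :=
      Real.logb_le_logb_of_le (by norm_num) hDpos hDg'.le
    rw [Real.logb_pow] at h1
    push_cast at h1
    linarith
  set k := Nat.log 2 m + 1 with hk
  have hmk : m < 2 ^ k := Nat.lt_pow_succ_log_self (by norm_num) m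
  have hlk : l < k := by
    rw [← hl, Real.logb_lt_iff_lt_rpow (by norm_num) (by linarith), Real.rpow_natCast]
    exact_mod_cast hmk
  have hkl : (k : ℝ) ≤ l + 1 := by
    have h1 : (2 : ℝ) ^ Nat.log 2 m ≤ m := by
      exact_mod_cast Nat.pow_log_le_self 2 (by omega)
    have h2 := Real.logb_le_logb_of_le (b := 2) (by norm_num) (by positivity) h1
    rw [logb_two_natCast_pow, hl] at h2
    rw [hk]
    push_cast
    linarith
  by_cases h1 : 2 * m ≤ g
  · refine ⟨48, SimpleGraph.hasSeparator_of_large_girth hd hg hS h1, ?_⟩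
    have : 0 ≤ (m : ℝ) / l * t ^ 2 := by positivity
    push_cast
    linarith
  by_cases h2 : 2 * k ^ 2 ≤ g
  · refine ⟨_, SimpleGraph.hasSeparator_of_girth hd hg hS (by omega) hmk h2, ?_⟩
    have hl2048 : 2048 ≤ l := by
      have h3 : (g : ℝ) + 1 ≤ 2 * m := by exact_mod_cast (by omega : g + 1 ≤ 2 * m)
      have h4 := Real.logb_le_logb_of_le (b := 2) (by norm_num) (by positivity) h3
      rw [Real.logb_mul (by norm_num) (by positivity), hl, Real.logb_self_eq_one (by norm_num)]
        at h4
      linarith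
    have ht10 : 10 ≤ t := by
      rw [← ht, Real.le_logb_iff_rpow_le (by norm_num) (by linarith)]
      norm_num
      linarith
    have h3 : ((2 * 48 * m / k : ℕ) : ℝ) ≤ ((2 * 48 * m : ℕ) : ℝ) / (k : ℕ) := Nat.cast_div_le
    have h4 : ((2 * 48 * m : ℕ) : ℝ) / (k : ℕ) ≤ m / l * t ^ 2 := by
      push_cast
      calc (96 * m : ℝ) / k ≤ 96 * m / l := by gcongr
        _ = m / l * 96 := by ring
        _ ≤ m / l * t ^ 2 := by
          gcongr
          nlinarith
    push_cast at h3 h4 ⊢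
    linarith
  · have h3 : (g : ℝ) + 1 ≤ 8 * l ^ 2 := by
      have h4 : (g : ℝ) + 1 ≤ 2 * (k : ℝ) ^ 2 := by
        exact_mod_cast (by omega : g + 1 ≤ 2 * k ^ 2)
      have h5 : (k : ℝ) ^ 2 ≤ (2 * l) ^ 2 := by
        gcongr
        linarith
      nlinarith
    have ht1 : 1294 ≤ t := by
      have h4 := Real.logb_le_logb_of_le (b := 2) (by norm_num) (by positivity) h3
      rw [Real.logb_mul (by norm_num) (by positivity), Real.logb_pow, ht,
        show (8 : ℝ) = 2 ^ 3 by norm_num, logb_two_natCast_pow] at h4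
      push_cast at h4
      linarith
    have hD1 : ((D + 1 : ℕ) : ℝ) ≤ 64 * l ^ 4 := by
      have h4 : ((D + 1 : ℕ) : ℝ) ≤ ((g : ℝ) + 1) ^ 2 := by rw [sq]; exact_mod_cast hDg
      have h5 : ((g : ℝ) + 1) ^ 2 ≤ (8 * l ^ 2) ^ 2 := by gcongr
      calc _ ≤ (8 * l ^ 2) ^ 2 := h4.trans h5
        _ = 64 * l ^ 4 := by ring
    have hl0 : 0 < l := by linarith
    have ht0 : 0 < t := by linarith
    have hc : 0 < t ^ 2 / l := by positivity
    refine ⟨_, hasSeparator_of_card_ge (R := ⌈96 * l / t ^ 2⌉₊) hd hH (c := t ^ 2 / l) ?_ hc ?_, ?_⟩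
    · calc (2 * (48 : ℕ) : ℝ) = t ^ 2 / l * (96 * l / t ^ 2) := by field_simp; norm_num
        _ ≤ t ^ 2 / l * ⌈96 * l / t ^ 2⌉₊ := by
          gcongr
          exact Nat.le_ceil _
    · exact three_mul_pow_le_of_logb hl ht (by omega) hl0 ht1 hD1
        (Nat.ceil_lt_add_one (by positivity)).le
    · refine (Nat.floor_le (by positivity)).trans ?_
      rw [div_mul_eq_mul_div, div_mul_eq_mul_div, mul_comm (t ^ 2)]
      linarith

end Cube

theorem le_logb_natLog_succ {n : ℕ} {a : ℝ} (ha : 0 < a)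
    (hn : a ≤ Real.logb 2 (Real.logb 2 n)) : a ≤ Real.logb 2 (Nat.log 2 n + 1 : ℕ) := by
  have hn0 : 0 < n := by
    rcases Nat.eq_zero_or_pos n with rfl | h
    · norm_num at hn
      linarith
    · exact h
  have hn1 : (1 : ℝ) ≤ n := by exact_mod_cast hn0
  have hl0 : 0 < Real.logb 2 n := by
    rcases (Real.logb_nonneg (b := 2) (by norm_num) hn1).eq_or_lt with h | h
    · rw [← h] at hn
      norm_num at hn
      linarith
    · exact h
  refine hn.trans (Real.logb_le_logb_of_le (by norm_num) hl0 (le_of_lt ?_))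
  rw [Real.logb_lt_iff_lt_rpow (by norm_num) (by linarith), Real.rpow_natCast]
  exact_mod_cast Nat.lt_pow_succ_log_self (by norm_num) n

theorem two_pow_lt_of_lt_logb {D k : ℕ} (h : (k : ℝ) < Real.logb 2 D) : 2 ^ k < D := by
  have hD : (0 : ℝ) < D := by
    rcases Nat.eq_zero_or_pos D with rfl | h'
    · have : (0 : ℝ) ≤ k := by positivity
      norm_num at h
      linarith
    · exact_mod_cast h'
  rw [Real.lt_logb_iff_rpow_lt (by norm_num) hD, Real.rpow_natCast] at h
  exact_mod_cast h

theorem rpow_le_two_pow {n D k : ℕ} (hn : n ≤ 2 ^ D) (hk : D ≤ 4608 * k) :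
    (n : ℝ) ^ ((1 : ℝ) / 4608) ≤ 2 ^ k := by
  have hk' : (D : ℝ) ≤ 4608 * k := by exact_mod_cast hk
  calc (n : ℝ) ^ ((1 : ℝ) / 4608) ≤ ((2 : ℝ) ^ (D : ℝ)) ^ ((1 : ℝ) / 4608) := by
        gcongr
        rw [Real.rpow_natCast]
        exact_mod_cast hn
    _ = 2 ^ ((D : ℝ) * (1 / 4608)) := by rw [Real.rpow_mul (by norm_num)]
    _ ≤ 2 ^ (k : ℝ) := by
        apply Real.rpow_le_rpow_of_exponent_le (by norm_num)
        linarith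
    _ = 2 ^ k := Real.rpow_natCast _ _

theorem ncard_neighborSet_comap_le {V W : Type*} [Finite V] (ι : V ↪ W) {H : SimpleGraph W}
    {d : ℕ} (hH : H.DegreesLE d) (v : V) : ((H.comap ι).neighborSet v).ncard ≤ d := by
  have := Fintype.ofFinite V
  have h := hH (ι v) (((H.comap ι).neighborSet v).toFinset.map ι) fun y hy => by
    obtain ⟨w, hw, rfl⟩ := Finset.mem_map.1 hy
    simpa using hw
  rwa [Finset.card_map, ← Set.ncard_eq_toFinset_card'] at h

theorem card_le_ncard_edgeSet_comap {V W : Type*} [Finite V] (ι : V ↪ W) {H : SimpleGraph W}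
    {E : Finset (Sym2 W)} (hE : H.edgeSet = E)
    (hι : ∀ x y, H.Adj x y → x ∈ Set.range ι ∧ y ∈ Set.range ι) :
    E.card ≤ (H.comap ι).edgeSet.ncard := by
  rw [← Set.ncard_coe_finset, ← hE,
    ← Set.ncard_image_of_injective _ (Sym2.map.injective ι.injective)]
  refine Set.ncard_le_ncard ?_ (Set.toFinite _)
  intro e he
  induction e using Sym2.ind with
  | _ x y =>
    obtain ⟨⟨u, rfl⟩, ⟨v, rfl⟩⟩ := hι x y he
    exact ⟨s(u, v), he, rfl⟩

/-- Corollary 2.14: for sufficiently large `n` (any `n` with `8 ≤ (1/648)·log log n`) there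
is an `n`-vertex graph `G` with average degree at least `8` and maximum degree at most `48`
such that (a) every spanning subgraph of `G` retaining at least half of the edges has a
connected component with at least `n^(1/4608)` vertices, and (b) every induced subgraph `H`
of `G` on `m ≥ 2` vertices satisfies `sep(H) ≤ (m/log m)(log log m)² + 48`. -/
theorem stmt14 (n : ℕ) (hn : (8 : ℝ) ≤ (1 / 648) * Real.logb 2 (Real.logb 2 n)) :
    ∃ G : SimpleGraph (Fin n),
      ((8 : ℝ) * n ≤ 2 * G.edgeSet.ncard) ∧
      (∀ v : Fin n, (G.neighborSet v).ncard ≤ 48) ∧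
      -- (a) not (1/2, q)-hyperfinite for q < n^(1/4608)
      (∀ G' : SimpleGraph (Fin n), G' ≤ G →
        G.edgeSet.ncard ≤ 2 * G'.edgeSet.ncard →
        ∃ c : G'.ConnectedComponent,
          (n : ℝ) ^ ((1 : ℝ) / 4608) ≤ (c.supp.ncard : ℝ)) ∧
      -- (b) small separators in every induced subgraph
      (∀ (s : Set (Fin n)) (m : ℕ), s.ncard = m → 2 ≤ m →
        (sep (G.induce s) : ℝ) ≤
          ((m : ℝ) / Real.logb 2 m) * (Real.logb 2 (Real.logb 2 m)) ^ 2 + 48) := by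
  have hn' : 5184 ≤ Real.logb 2 (Real.logb 2 n) := by linarith
  have hlogD := le_logb_natLog_succ (by norm_num) hn'
  have hn0 : n ≠ 0 := by
    rintro rfl
    norm_num at hn
  have hnD : n < 2 ^ (Nat.log 2 n + 1) := Nat.lt_pow_succ_log_self (by norm_num) n
  have hX := Cube.le_card_edgesIn_initialSegment hn0
  have hXcard := Cube.card_initialSegment hnD.le
  have hXmem : ∀ w, w ∈ Cube.initialSegment (Nat.log 2 n + 1) n ↔
      ∃ x : Fin n, Cube.ofNat (Nat.log 2 n + 1) x = w := by
    intro w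
    simp only [Cube.initialSegment, Finset.mem_image, Finset.mem_range]
    exact ⟨fun ⟨x, hx, h⟩ => ⟨⟨x, hx⟩, h⟩, fun ⟨x, h⟩ => ⟨x, x.2, h⟩⟩
  generalize Nat.log 2 n + 1 = D at *
  have hD : 2 ^ 40 < D := two_pow_lt_of_lt_logb (by push_cast; linarith)
  have hgg : Nat.sqrt D * Nat.sqrt D ≤ D := Nat.sqrt_le D
  have hDg : D < (Nat.sqrt D + 1) * (Nat.sqrt D + 1) := Nat.lt_succ_sqrt D
  have hg : 10 ^ 5 ≤ Nat.sqrt D := Nat.le_sqrt.2 (by omega)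
  obtain ⟨H, E, hHE, hEX, hE, hdeg, hgirth, hdense⟩ :=
    Cube.exists_sparse_subgraph (K := D / 10) (k := D / 4608 + 1) (g := Nat.sqrt D)
      (Cube.initialSegment D n) hX (by omega) (by omega) (by omega) hg hgg
  rw [hXcard] at hE
  have hadj : ∀ x y, H.Adj x y → x ∈ Cube.initialSegment D n ∧ ∃ i, y = x + Cube.unit i := by
    intro x y hxy
    have h1 : s(x, y) ∈ E := by
      rw [← Finset.mem_coe, ← hHE]
      exact hxy
    obtain ⟨z, hz, i, hzi, h⟩ := Cube.mem_edgesIn.1 (hEX h1)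
    rcases Sym2.eq_iff.1 h with ⟨rfl, rfl⟩ | ⟨rfl, rfl⟩
    · exact ⟨hz, i, rfl⟩
    · exact ⟨hzi, i, (Cube.add_unit_add_unit _ _).symm⟩
  have hunit : ∀ x y, H.Adj x y → ∃ i, y = x + Cube.unit i := fun x y h => (hadj x y h).2
  let ι : Fin n ↪ Cube D := ⟨fun x => Cube.ofNat D x, fun x y h =>
    Fin.ext (Cube.ofNat_injOn (x.2.trans hnD) (y.2.trans hnD) h)⟩
  have hedges : 4 * n ≤ (H.comap ι).edgeSet.ncard :=
    hE.trans (card_le_ncard_edgeSet_comap ι hHE fun x y h =>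
      ⟨(hXmem x).1 (hadj x y h).1, (hXmem y).1 (hadj y x h.symm).1⟩)
  refine ⟨H.comap ι, ?_, ncard_neighborSet_comap_le ι hdeg, ?_, ?_⟩
  · have : (4 : ℝ) * n ≤ (H.comap ι).edgeSet.ncard := by exact_mod_cast hedges
    linarith
  · intro G' hG' hcard
    have : Nonempty (Fin n) := ⟨⟨0, Nat.pos_of_ne_zero hn0⟩⟩
    obtain ⟨c, hc⟩ := Cube.exists_connectedComponent_two_pow_lt hunit ι
      (fun v => hdense _ ((hXmem _).2 ⟨v, rfl⟩)) hG' (by rw [Fintype.card_fin]; omega)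
    refine ⟨c, (rpow_le_two_pow hnD.le (k := D / 4608 + 1) (by omega)).trans ?_⟩
    exact_mod_cast hc.le
  · intro s m hs hm
    have hS : ∀ w, w ∈ s.toFinset.map ι ↔ ∃ v ∈ s, ι v = w := by simp
    have hScard : (s.toFinset.map ι).card = m := by
      rw [Finset.card_map, ← Set.ncard_eq_toFinset_card', hs]
    obtain ⟨c, hc, hcm⟩ :=
      Cube.exists_hasSeparator hdeg hunit hgirth hDg hlogD (hm.trans_eq hScard.symm)
    rw [hScard] at hcm
    refine le_trans ?_ hcm
    exact_mod_cast sep_induce_comap_le ι H hS hc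
end

section
/- Let n, k be integers with 2 ≤ k ≤ (1/648)·log log log n, and let G be an n-vertex graph satisfying: (i) average degree at least k and maximum degree at most 6k; (ii) girth at least log n/(6k)²; and (iii) every subgraph H of G on t ≥ log n/(6k)² vertices satisfies sep(H) ≤ (t/log t)·(log log t)². Then for every subgraph H of G on t vertices with t ≥ (1/2)·log n/(6k)² and every real μ with 1/t ≤ μ ≤ 2/3, there exists a subset A ⊆ V(H) with μt/3 ≤ |A| ≤ μt satisfying φ_H(A) ≤ (log(1/μ)/log t)·(4·log log t)². -/
open SimpleGraph

/-- `phi G A = |∂_G(A)| / |A|`, the edge expansion of `A` in `G`. -/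
noncomputable def phi {V : Type*} (G : SimpleGraph V) (A : Set V) : ℝ :=
  (cutEdges G A).ncard / A.ncard

section CutCount

variable {V W : Type*}

open Classical in
/-- The number of pairs in `A × B` that are adjacent in `F`. -/
noncomputable def cutCount (F : SimpleGraph V) (A B : Finset V) : ℕ :=
  ∑ a ∈ A, ∑ b ∈ B, if F.Adj a b then 1 else 0

lemma cutCount_comm (F : SimpleGraph V) (A B : Finset V) :
    cutCount F A B = cutCount F B A := by
  unfold cutCount
  rw [Finset.sum_comm]
  exact Finset.sum_congr rfl fun b _ => Finset.sum_congr rfl fun a _ => by rw [F.adj_comm]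

lemma cutCount_map {F' : SimpleGraph W} {F : SimpleGraph V} (f : F' ↪g F) (A B : Finset W) :
    cutCount F (A.map f.toEmbedding) (B.map f.toEmbedding) = cutCount F' A B := by
  classical
  simp only [cutCount, Finset.sum_map]
  exact Finset.sum_congr rfl fun a _ => Finset.sum_congr rfl fun b _ => by
    exact if_congr f.map_adj_iff rfl rfl

lemma ncard_cutEdges [Fintype V] [DecidableEq V] (F : SimpleGraph V) (A : Finset V) :
    (cutEdges F (A : Set V)).ncard = cutCount F A Aᶜ := by
  classical
  have h : cutCount F A Aᶜ = ((A ×ˢ Aᶜ).filter (fun p => F.Adj p.1 p.2)).card := by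
    rw [Finset.card_filter, Finset.sum_product]
    rfl
  have himage : cutEdges F (A : Set V) =
      (fun p : V × V => s(p.1, p.2)) '' ((A ×ˢ Aᶜ).filter (fun p => F.Adj p.1 p.2)) := by
    ext e
    simp only [cutEdges, Set.mem_ofPred_eq, Set.mem_image, Finset.mem_coe, Finset.mem_filter,
      Finset.mem_product, Finset.mem_compl, Set.mem_compl_iff, Prod.exists]
    constructor
    · rintro ⟨he, u, hu, v, hv, rfl⟩
      exact ⟨u, v, ⟨⟨hu, hv⟩, he⟩, rfl⟩
    · rintro ⟨u, v, ⟨⟨hu, hv⟩, he⟩, rfl⟩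
      exact ⟨he, u, hu, v, hv, rfl⟩
  rw [h, himage, Set.InjOn.ncard_image, Set.ncard_coe_finset]
  rintro ⟨a, b⟩ hab ⟨c, d⟩ hcd heq
  simp only [Finset.mem_coe, Finset.mem_filter, Finset.mem_product, Finset.mem_compl] at hab hcd
  rcases Sym2.eq_iff.1 heq with ⟨h1, h2⟩ | ⟨h1, h2⟩
  · exact Prod.ext h1 h2
  · obtain rfl : a = d := h1
    exact absurd hab.1.1 hcd.1.2

/-- Splitting a set in two raises the sum of the boundaries by twice the size of the cut. -/
lemma cutCount_compl_add [Fintype V] [DecidableEq V] (F : SimpleGraph V) {S₁ S₂ : Finset V} (h : Disjoint S₁ S₂) :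
    cutCount F S₁ S₁ᶜ + cutCount F S₂ S₂ᶜ =
      cutCount F (S₁ ∪ S₂) (S₁ ∪ S₂)ᶜ + 2 * cutCount F S₁ S₂ := by
  have h₁ : S₁ᶜ = (S₁ ∪ S₂)ᶜ ∪ S₂ := by
    ext x
    have : x ∈ S₁ → x ∉ S₂ := fun hx => Finset.disjoint_left.1 h hx
    simp only [Finset.mem_compl, Finset.mem_union]
    tauto
  have h₂ : S₂ᶜ = (S₁ ∪ S₂)ᶜ ∪ S₁ := by
    ext x
    have : x ∈ S₁ → x ∉ S₂ := fun hx => Finset.disjoint_left.1 h hx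
    simp only [Finset.mem_compl, Finset.mem_union]
    tauto
  have hd₁ : Disjoint (S₁ ∪ S₂)ᶜ S₂ :=
    (disjoint_compl_left (a := S₁ ∪ S₂)).mono_right Finset.subset_union_right
  have hd₂ : Disjoint (S₁ ∪ S₂)ᶜ S₁ :=
    (disjoint_compl_left (a := S₁ ∪ S₂)).mono_right Finset.subset_union_left
  have e₁ : cutCount F S₁ S₁ᶜ = cutCount F S₁ (S₁ ∪ S₂)ᶜ + cutCount F S₁ S₂ := by
    rw [h₁]
    simp only [cutCount, Finset.sum_union hd₁, Finset.sum_add_distrib]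
  have e₂ : cutCount F S₂ S₂ᶜ = cutCount F S₂ (S₁ ∪ S₂)ᶜ + cutCount F S₂ S₁ := by
    rw [h₂]
    simp only [cutCount, Finset.sum_union hd₂, Finset.sum_add_distrib]
  have e₃ : cutCount F (S₁ ∪ S₂) (S₁ ∪ S₂)ᶜ =
      cutCount F S₁ (S₁ ∪ S₂)ᶜ + cutCount F S₂ (S₁ ∪ S₂)ᶜ := Finset.sum_union h
  rw [e₁, e₂, e₃, cutCount_comm F S₂ S₁]
  ring

lemma cutCount_le_mul [Finite V] (F : SimpleGraph V) {d : ℕ} (hd : ∀ v, (F.neighborSet v).ncard ≤ d)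
    (A B : Finset V) : cutCount F A B ≤ d * A.card := by
  classical
  rw [mul_comm, ← smul_eq_mul]
  refine Finset.sum_le_card_nsmul _ _ _ fun a _ => ?_
  rw [← Finset.card_filter, ← Set.ncard_coe_finset]
  refine (Set.ncard_le_ncard ?_ (Set.toFinite _)).trans (hd a)
  intro b hb
  simpa using (Finset.mem_filter.1 hb).2

/-- An edge separator of an induced subgraph splits its vertex set inside the ambient graph. -/
lemma exists_split_of_sep [DecidableEq V] [Fintype W] {F' : SimpleGraph W} {F : SimpleGraph V} (f : F' ↪g F)
    (hW : 2 ≤ Fintype.card W) :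
    ∃ S₁ S₂ : Finset V, Disjoint S₁ S₂ ∧ S₁ ∪ S₂ = Finset.univ.map f.toEmbedding ∧
      3 * S₁.card ≤ 2 * Fintype.card W ∧ 3 * S₂.card ≤ 2 * Fintype.card W ∧
      cutCount F S₁ S₂ = sep F' := by
  classical
  have hne : { m : ℕ | ∃ A : Set W, 3 * A.ncard ≤ 2 * Nat.card W ∧
      3 * Aᶜ.ncard ≤ 2 * Nat.card W ∧ m = (cutEdges F' A).ncard }.Nonempty := by
    obtain ⟨A, -, hA⟩ := Finset.exists_subset_card_eq
      (show Fintype.card W / 2 ≤ (Finset.univ : Finset W).card by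
        rw [Finset.card_univ]; omega)
    refine ⟨_, (A : Set W), ?_, ?_, rfl⟩
    · rw [Set.ncard_coe_finset, Nat.card_eq_fintype_card]; omega
    · rw [← Finset.coe_compl, Set.ncard_coe_finset, Nat.card_eq_fintype_card, Finset.card_compl]
      omega
  obtain ⟨A, hA, hAc, hm⟩ := Nat.sInf_mem hne
  lift A to Finset W using Set.toFinite _
  rw [← Finset.coe_compl] at hAc
  rw [Set.ncard_coe_finset, Nat.card_eq_fintype_card] at hA hAc
  refine ⟨A.map f.toEmbedding, Aᶜ.map f.toEmbedding, ?_, ?_, ?_, ?_, ?_⟩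
  · exact (Finset.disjoint_map _).2 disjoint_compl_right
  · rw [← Finset.map_union, Finset.union_compl]
  · rwa [Finset.card_map]
  · rwa [Finset.card_map]
  · rw [cutCount_map, ← ncard_cutEdges]
    exact hm.symm

/-- If every large set can be split in a balanced way along few edges, then iterated splitting
produces sets of prescribed size and small boundary. -/
lemma exists_small_boundary [Fintype V] [DecidableEq V] (F : SimpleGraph V) {β s : ℝ}
    (hsplit : ∀ S : Finset V, s < S.card → ∃ S₁ S₂ : Finset V, Disjoint S₁ S₂ ∧ S₁ ∪ S₂ = S ∧
      3 * S₁.card ≤ 2 * S.card ∧ 3 * S₂.card ≤ 2 * S.card ∧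
      (cutCount F S₁ S₂ : ℝ) ≤ β * S.card)
    (S : Finset V) (hS₀ : 0 < S.card) (hS : s < S.card) (j : ℕ)
    (hj : (3 / 2 : ℝ) ^ j * S.card ≤ Fintype.card V)
    (hcut : (cutCount F S Sᶜ : ℝ) ≤ 2 * β * j * S.card) :
    ∃ (A : Finset V) (i : ℕ), s / 3 ≤ A.card ∧ (A.card : ℝ) ≤ s ∧
      (3 / 2 : ℝ) ^ i * s < Fintype.card V ∧
      (cutCount F A Aᶜ : ℝ) ≤ 2 * β * (i + 1) * A.card := by
  induction hc : S.card using Nat.strong_induction_on generalizing S j with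
  | _ c ih =>
  obtain ⟨S₁, S₂, hd, hu, h₁, h₂, hb⟩ := hsplit S hS
  have hcard : S₁.card + S₂.card = S.card := by rw [← hu, Finset.card_union_of_disjoint hd]
  have hadd := cutCount_compl_add F hd
  rw [hu] at hadd
  have key : ∃ T : Finset V, S.card ≤ 3 * T.card ∧ 3 * T.card ≤ 2 * S.card ∧
      (cutCount F T Tᶜ : ℝ) ≤ 2 * β * (j + 1) * T.card := by
    by_contra! hcon
    have c₁ := hcon S₁ (by omega) h₁
    have c₂ := hcon S₂ (by omega) h₂
    have hadd' : (cutCount F S₁ S₁ᶜ : ℝ) + cutCount F S₂ S₂ᶜ =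
      cutCount F S Sᶜ + 2 * cutCount F S₁ S₂ := by exact_mod_cast hadd
    have hcard' : (S₁.card : ℝ) + S₂.card = S.card := by exact_mod_cast hcard
    rw [← hcard'] at hcut hb
    nlinarith
  obtain ⟨T, hT₁, hT₂, hT⟩ := key
  have hT₁' : (S.card : ℝ) ≤ 3 * T.card := by exact_mod_cast hT₁
  have hT₂' : 3 * (T.card : ℝ) ≤ 2 * S.card := by exact_mod_cast hT₂
  have hpow : (0 : ℝ) < (3 / 2) ^ j := by positivity
  rcases le_or_gt (T.card : ℝ) s with hle | hlt
  · exact ⟨T, j, by linarith, hle, by nlinarith, hT⟩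
  · refine ih T.card (by omega) T (by omega) hlt (j + 1) ?_ (by push_cast; exact hT) rfl
    rw [pow_succ]
    nlinarith

end CutCount

section Forest

variable {W : Type*} [Fintype W]

/-- If all edges of the boundary of `A` meet a common vertex, then the boundary is at most the
maximum degree. -/
lemma ncard_cutEdges_le_of_common_vertex {F : SimpleGraph W} {d : ℕ}
    (hd : ∀ v, (F.neighborSet v).ncard ≤ d) {A : Set W} {v : W}
    (h : ∀ a ∈ A, ∀ b ∉ A, F.Adj a b → a = v ∨ b = v) : (cutEdges F A).ncard ≤ d := by
  have hsub : cutEdges F A ⊆ (fun w => s(v, w)) '' F.neighborSet v := by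
    rintro e ⟨he, a, ha, b, hb, rfl⟩
    have hab : F.Adj a b := he
    rcases h a ha b hb hab with rfl | rfl
    · exact ⟨b, hab, rfl⟩
    · exact ⟨a, hab.symm, Sym2.eq_swap⟩
  exact (Set.ncard_le_ncard hsub (Set.toFinite _)).trans
    ((Set.ncard_image_le (Set.toFinite _)).trans (hd v))

/-- A forest with at least two vertices has an edge separator of size at most its maximum
degree. -/
lemma sep_le_of_isAcyclic {F : SimpleGraph W} (hF : F.IsAcyclic) {d : ℕ}
    (hd : ∀ v, (F.neighborSet v).ncard ≤ d) (hW : 2 ≤ Fintype.card W) : sep F ≤ d := by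
  classical
  suffices h : ∃ (A : Finset W) (v : W), Fintype.card W ≤ 3 * A.card ∧
      3 * A.card ≤ 2 * Fintype.card W ∧ ∀ a ∈ A, ∀ b ∉ A, F.Adj a b → a = v ∨ b = v by
    obtain ⟨A, v, h₁, h₂, h₃⟩ := h
    refine le_trans (Nat.sInf_le ⟨(A : Set W), ?_, ?_, rfl⟩)
      (ncard_cutEdges_le_of_common_vertex hd (v := v) (by exact_mod_cast h₃))
    · rwa [Set.ncard_coe_finset, Nat.card_eq_fintype_card]
    · rw [← Finset.coe_compl, Set.ncard_coe_finset, Nat.card_eq_fintype_card, Finset.card_compl]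
      omega
  let good : Finset W → Prop := fun S =>
    Fintype.card W ≤ 3 * S.card ∧ ∃ v ∈ S, ∀ a ∈ S, ∀ b ∉ S, F.Adj a b → a = v
  obtain ⟨x⟩ : Nonempty W := Fintype.card_pos_iff.1 (by omega)
  obtain ⟨S, hS, hmin⟩ := Finset.exists_min_image (Finset.univ.filter good) Finset.card
    ⟨Finset.univ, by simp [good, Finset.card_univ]; exact ⟨by omega, ⟨x⟩⟩⟩
  obtain ⟨hScard, v, hvS, hv⟩ := (Finset.mem_filter.1 hS).2
  by_cases hS₂ : 3 * S.card ≤ 2 * Fintype.card W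
  · exact ⟨S, v, hScard, hS₂, fun a ha b hb hab => Or.inl (hv a ha b hb hab)⟩
  let closed : Finset W → Prop := fun T =>
    T ⊆ S ∧ 3 * T.card ≤ 2 * Fintype.card W ∧ ∀ a ∈ T, ∀ b ∉ T, F.Adj a b → b = v
  obtain ⟨T, hT, hmax⟩ := Finset.exists_max_image (Finset.univ.filter closed) Finset.card
    ⟨∅, by simp [closed]⟩
  obtain ⟨hTS, hTcard, hTv⟩ := (Finset.mem_filter.1 hT).2
  by_cases hT₂ : Fintype.card W ≤ 3 * T.card
  · exact ⟨T, v, hT₂, hTcard, fun a ha b hb hab => Or.inr (hTv a ha b hb hab)⟩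
  exfalso
  obtain ⟨u, hu⟩ : ((S.erase v) \ T).Nonempty := by
    rw [← Finset.card_pos]
    have h₁ := Finset.le_card_sdiff T (S.erase v)
    rw [Finset.card_erase_of_mem hvS] at h₁
    omega
  simp only [Finset.mem_sdiff, Finset.mem_erase] at hu
  obtain ⟨⟨huv, huS⟩, huT⟩ := hu
  let F' : SimpleGraph W :=
    { Adj := fun a b => F.Adj a b ∧ a ≠ v ∧ b ≠ v
      symm := ⟨fun a b h => ⟨h.1.symm, h.2.2, h.2.1⟩⟩
      loopless := ⟨fun a h => F.irrefl h.1⟩ }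
  let C : Finset W := Finset.univ.filter fun w => F'.Reachable u w
  have memC : ∀ w, w ∈ C ↔ F'.Reachable u w := fun w => by simp [C]
  have hCS : ∀ w ∈ C, w ∈ S ∧ w ≠ v := by
    intro w hw
    rw [memC, SimpleGraph.reachable_iff_reflTransGen] at hw
    induction hw with
    | refl => exact ⟨huS, huv⟩
    | tail _ hbc ih =>
      refine ⟨?_, hbc.2.2⟩
      by_contra hcon
      exact hbc.2.1 (hv _ ih.1 _ hcon hbc.1)
  have hCv : ∀ a ∈ C, ∀ b ∉ C, F.Adj a b → b = v := by
    intro a ha b hb hab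
    by_contra hbv
    have hadj : F'.Adj a b := ⟨hab, (hCS a ha).2, hbv⟩
    exact hb ((memC b).2 (((memC a).1 ha).trans hadj.reachable))
  have huniq : ∀ a ∈ C, ∀ b ∈ C, F.Adj v a → F.Adj v b → b = a := by
    intro a ha b hb hva hvb
    by_contra hne
    have hbridge := SimpleGraph.isAcyclic_iff_forall_adj_isBridge.1 hF hva
    rw [SimpleGraph.isBridge_iff] at hbridge
    have hle : F' ≤ F.deleteEdges {s(v, a)} := by
      intro p q hpq
      refine SimpleGraph.deleteEdges_adj.2 ⟨hpq.1, fun h₁ => ?_⟩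
      rw [Set.mem_singleton_iff, Sym2.eq_iff] at h₁
      rcases h₁ with h₁ | h₁
      · exact hpq.2.1 h₁.1
      · exact hpq.2.2 h₁.2
    have hadj : (F.deleteEdges {s(v, a)}).Adj v b := by
      refine SimpleGraph.deleteEdges_adj.2 ⟨hvb, fun h₁ => ?_⟩
      rw [Set.mem_singleton_iff, Sym2.eq_iff] at h₁
      rcases h₁ with h₁ | h₁
      · exact hne h₁.2
      · exact (hCS b hb).2 h₁.2
    exact hbridge (hadj.reachable.trans
      ((((memC b).1 hb).symm.trans ((memC a).1 ha)).mono hle))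
  have huC : u ∈ C := (memC u).2 (SimpleGraph.Reachable.refl u)
  have hCgood : ∃ z ∈ C, ∀ a ∈ C, ∀ b ∉ C, F.Adj a b → a = z := by
    by_cases hex : ∃ a ∈ C, F.Adj v a
    · obtain ⟨z, hz, hvz⟩ := hex
      refine ⟨z, hz, fun a ha b hb hab => huniq z hz a ha hvz ?_⟩
      rw [← hCv a ha b hb hab]
      exact hab.symm
    · refine ⟨u, huC, fun a ha b hb hab => (hex ⟨a, ha, ?_⟩).elim⟩
      rw [← hCv a ha b hb hab]
      exact hab.symm
  have hClt : C.card < S.card := by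
    apply Finset.card_lt_card
    exact ⟨fun w hw => (hCS w hw).1, fun hcon => (hCS v (hcon hvS)).2 rfl⟩
  have hCsmall : 3 * C.card < Fintype.card W := by
    by_contra hcon
    have := hmin C (Finset.mem_filter.2 ⟨Finset.mem_univ _, by omega, hCgood⟩)
    omega
  have hTC : closed (T ∪ C) := by
    refine ⟨Finset.union_subset hTS fun w hw => (hCS w hw).1, ?_, ?_⟩
    · have := Finset.card_union_le T C
      omega
    · intro a ha b hb hab
      rw [Finset.mem_union, not_or] at hb
      rcases Finset.mem_union.1 ha with h | h
      · exact hTv a h b hb.1 hab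
      · exact hCv a h b hb.2 hab
  have hlt : T.card < (T ∪ C).card := by
    apply Finset.card_lt_card
    exact ⟨Finset.subset_union_left, fun hcon => huT (hcon (Finset.mem_union_right _ huC))⟩
  have := hmax _ (Finset.mem_filter.2 ⟨Finset.mem_univ _, hTC⟩)
  omega

/-- A graph that embeds into a graph of girth larger than its order is a forest. -/
lemma isAcyclic_of_girth {V : Type*} {G : SimpleGraph V} {F : SimpleGraph W} (f : F →g G)
    (hf : Function.Injective f)
    (h : ∀ (v : V) (w : G.Walk v v), w.IsCycle → Fintype.card W < w.length) : F.IsAcyclic := by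
  intro v w hw
  have h₁ := h _ (w.map f) (hw.map hf)
  have h₂ := hw.support_nodup.length_le_card
  rw [SimpleGraph.Walk.length_map] at h₁
  simp at h₂
  omega

end Forest

section Estimates

lemma one_add_le_two_rpow {x : ℝ} (hx : 1 ≤ x) : 1 + x ≤ (2 : ℝ) ^ x := by
  have h := one_add_mul_self_le_rpow_one_add (s := 1) (by norm_num) hx
  norm_num at h
  exact h

lemma le_two_rpow_half {x : ℝ} (hx : 4 ≤ x) : x ≤ (2 : ℝ) ^ (x / 2) := by
  have h := one_add_le_two_rpow (x := x / 4) (by linarith)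
  have e : (2 : ℝ) ^ (x / 2) = (2 : ℝ) ^ (x / 4) * (2 : ℝ) ^ (x / 4) := by
    rw [← Real.rpow_add two_pos]
    ring_nf
  rw [e]
  nlinarith [sq_nonneg (1 - x / 4)]

lemma sq_le_two_rpow {x : ℝ} (hx : 16 ≤ x) : x ^ 2 ≤ (2 : ℝ) ^ x := by
  have h := one_add_le_two_rpow (x := x / 4) (by linarith)
  have e : (2 : ℝ) ^ x = ((2 : ℝ) ^ (x / 4)) ^ 2 * ((2 : ℝ) ^ (x / 4)) ^ 2 := by
    rw [← mul_pow, ← Real.rpow_add two_pos, ← Real.rpow_natCast, ← Real.rpow_mul two_pos.le]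
    ring_nf
  have h₂ : x ≤ ((2 : ℝ) ^ (x / 4)) ^ 2 := by nlinarith
  rw [e]
  nlinarith

/-- Every `t` above the size threshold satisfies `6 k ≤ log log t`. -/
lemma six_mul_le_loglog {n k : ℕ} (hk2 : 2 ≤ k)
    (hk : (k : ℝ) ≤ (1 / 648) * Real.logb 2 (Real.logb 2 (Real.logb 2 n))) {t : ℝ}
    (ht : (1 / 2) * (Real.logb 2 n / (6 * k : ℝ) ^ 2) ≤ t) :
    0 < t ∧ 12 ≤ Real.logb 2 t ∧ 6 * (k : ℝ) ≤ Real.logb 2 (Real.logb 2 t) := by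
  have hk2' : (2 : ℝ) ≤ k := by exact_mod_cast hk2
  set L := Real.logb 2 n with hL
  set B := Real.logb 2 L with hB
  set C := Real.logb 2 B with hC
  have hC₁ : 648 * (k : ℝ) ≤ C := by linarith
  have hB₀ : B ≠ 0 := fun h => by
    rw [h, Real.logb_zero] at hC
    linarith
  have hL₀ : L ≠ 0 := fun h => hB₀ (by rw [hB, h, Real.logb_zero])
  have hn : 2 ≤ n := by
    by_contra hcon
    interval_cases n <;> simp at hL <;> exact hL₀ hL
  have hL₁ : 1 ≤ L := by
    rw [hL, Real.le_logb_iff_rpow_le one_lt_two (by positivity), Real.rpow_one]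
    exact_mod_cast hn
  have hB₁ : 0 < B := lt_of_le_of_ne (Real.logb_nonneg one_lt_two hL₁) hB₀.symm
  have hBC : (2 : ℝ) ^ C = B := Real.rpow_logb two_pos (by norm_num) hB₁
  have hLB : (2 : ℝ) ^ B = L := Real.rpow_logb two_pos (by norm_num) (by linarith)
  have hCB : C ^ 2 ≤ B := hBC ▸ sq_le_two_rpow (by linarith)
  have hBh : B ≤ (2 : ℝ) ^ (B / 2) := le_two_rpow_half (by nlinarith)
  have hsq : L = (2 : ℝ) ^ (B / 2) * (2 : ℝ) ^ (B / 2) := by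
    rw [← Real.rpow_add two_pos, add_halves, hLB]
  have ht₁ : (2 : ℝ) ^ (B / 2) ≤ t := by
    refine le_trans ?_ ht
    rw [← mul_div_assoc, le_div_iff₀ (by positivity)]
    have h₁ : 2 * (6 * (k : ℝ)) ^ 2 ≤ (2 : ℝ) ^ (B / 2) := by nlinarith
    have h₂ : (0 : ℝ) < (2 : ℝ) ^ (B / 2) := by positivity
    nlinarith
  have ht₀ : 0 < t := lt_of_lt_of_le (by positivity) ht₁
  have hX : B / 2 ≤ Real.logb 2 t := (Real.le_logb_iff_rpow_le one_lt_two ht₀).2 ht₁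
  refine ⟨ht₀, by nlinarith, ?_⟩
  rw [Real.le_logb_iff_rpow_le one_lt_two (by nlinarith)]
  refine le_trans ?_ hX
  rw [← hBC]
  have h₃ : (2 : ℝ) ^ C / 2 = (2 : ℝ) ^ (C - 1) := by
    rw [Real.rpow_sub two_pos, Real.rpow_one]
  rw [h₃]
  exact Real.rpow_le_rpow_of_exponent_le one_le_two (by linarith)

/-- The function `(log log s)² / log s` on `[√t, t]` is at most twice its value at `t`, and it
dominates `d / s` as soon as `d ≤ log log t`. -/
lemma sep_bound_uniform {s t d : ℝ} (hs : 0 < s) (ht : 12 ≤ Real.logb 2 t)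
    (hst : Real.logb 2 t / 2 ≤ Real.logb 2 s) (hts : Real.logb 2 s ≤ Real.logb 2 t)
    (hd₁ : 1 ≤ d) (hd : d ≤ Real.logb 2 (Real.logb 2 t)) :
    s / Real.logb 2 s * Real.logb 2 (Real.logb 2 s) ^ 2 ≤
        2 * Real.logb 2 (Real.logb 2 t) ^ 2 / Real.logb 2 t * s ∧
      d ≤ 2 * Real.logb 2 (Real.logb 2 t) ^ 2 / Real.logb 2 t * s := by
  set X := Real.logb 2 t
  set Y := Real.logb 2 s with hY
  set l := Real.logb 2 X
  have hX₀ : 0 < X := by linarith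
  have hY₀ : 0 < Y := by linarith
  have hl : Real.logb 2 Y ≤ l := Real.logb_le_logb_of_le one_lt_two hY₀ hts
  have hl₀ : 0 ≤ Real.logb 2 Y := Real.logb_nonneg one_lt_two (by linarith)
  have hsq : Real.logb 2 Y ^ 2 ≤ l ^ 2 := pow_le_pow_left₀ hl₀ hl 2
  constructor
  · have h₁ : 1 / Y ≤ 2 / X := by
      rw [div_le_div_iff₀ hY₀ hX₀]
      linarith
    calc s / Y * Real.logb 2 Y ^ 2 = (1 / Y) * Real.logb 2 Y ^ 2 * s := by ring
      _ ≤ (2 / X) * l ^ 2 * s := by gcongr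
      _ = _ := by ring
  · have h₁ : 1 + Y ≤ s := by
      have h := one_add_le_two_rpow (x := Y) (by linarith)
      rwa [hY, Real.rpow_logb two_pos (by norm_num) hs] at h
    have h₂ : X ≤ 2 * l * s := by nlinarith
    rw [div_mul_eq_mul_div, le_div_iff₀ hX₀]
    nlinarith

/-- The number of balanced splittings needed to get from size `t` below size `μ t`. -/
lemma succ_le_four_mul_logb {μ : ℝ} {i : ℕ} (hμ₀ : 0 < μ) (hμ : μ ≤ 2 / 3)
    (hi : (3 / 2 : ℝ) ^ i * μ ≤ 1) : (i : ℝ) + 1 ≤ 4 * Real.logb 2 (1 / μ) := by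
  have h32 : (1 / 2 : ℝ) ≤ Real.logb 2 (3 / 2) := by
    have h : (1 : ℝ) ≤ Real.logb 2 ((3 / 2) ^ 2) := by
      rw [Real.le_logb_iff_rpow_le one_lt_two (by norm_num)]
      norm_num
    rw [Real.logb_pow] at h
    push_cast at h
    linarith
  have h₁ : Real.logb 2 (3 / 2) ≤ Real.logb 2 (1 / μ) := by
    apply Real.logb_le_logb_of_le one_lt_two (by norm_num)
    rw [le_div_iff₀ hμ₀]
    linarith
  have h₂ : (i : ℝ) * Real.logb 2 (3 / 2) ≤ Real.logb 2 (1 / μ) := by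
    rw [← Real.logb_pow]
    apply Real.logb_le_logb_of_le one_lt_two (by positivity)
    rwa [le_div_iff₀ hμ₀]
  nlinarith [(Nat.cast_nonneg i : (0 : ℝ) ≤ i)]

end Estimates

lemma phi_le {W : Type*} [Fintype W] [DecidableEq W] {F : SimpleGraph W} {A : Finset W} {c : ℝ}
    (hA : 0 < A.card) (h : (cutCount F A Aᶜ : ℝ) ≤ c * A.card) : phi F (A : Set W) ≤ c := by
  have hA' : (0 : ℝ) < A.card := by exact_mod_cast hA
  rw [phi, ncard_cutEdges, Set.ncard_coe_finset, div_le_iff₀ hA']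
  exact h

/-- The coercion of `H.induce S`, for `S` a set of vertices of `H`, is an induced subgraph of the
coercion of `H`. -/
def induceCoeEmbedding {V : Type*} {G : SimpleGraph V} (H : G.Subgraph) (S : Set H.verts) :
    (H.induce (Subtype.val '' S)).coe ↪g H.coe where
  toFun x := ⟨x.1, by
    obtain ⟨y, -, hy⟩ := x.2
    exact hy ▸ y.2⟩
  inj' x y hxy := Subtype.ext (congrArg (fun z : H.verts => (z : V)) hxy)
  map_rel_iff' {x y} := by
    simp only [SimpleGraph.Subgraph.coe_adj, SimpleGraph.Subgraph.induce_adj]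
    exact ⟨fun h => ⟨x.2, y.2, h⟩, fun h => h.2.2⟩

lemma range_induceCoeEmbedding {V : Type*} {G : SimpleGraph V} (H : G.Subgraph)
    (S : Set H.verts) : Set.range (induceCoeEmbedding H S) = S := by
  ext x
  constructor
  · rintro ⟨⟨_, y, hy, rfl⟩, rfl⟩
    exact hy
  · exact fun hx => ⟨⟨x.1, x, hx, rfl⟩, rfl⟩

lemma ncard_neighborSet_coe_le {V : Type*} [Finite V] {G : SimpleGraph V} (K : G.Subgraph)
    {d : ℕ} (hd : ∀ v, (G.neighborSet v).ncard ≤ d) (v : K.verts) :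
    (K.coe.neighborSet v).ncard ≤ d := by
  rw [← Set.ncard_image_of_injective _ Subtype.val_injective]
  refine (Set.ncard_le_ncard ?_ (Set.toFinite _)).trans (hd v)
  rintro _ ⟨w, hw, rfl⟩
  exact K.coe_adj_sub v w hw

/-- First part of the proof of Theorem 1.4: if `G` is an `n`-vertex graph with average
degree ≥ `k`, maximum degree ≤ `6k`, girth ≥ `log n/(6k)²`, where
`2 ≤ k ≤ (1/648)·log log log n`, and every subgraph on `t ≥ log n/(6k)²` vertices has
`sep ≤ (t/log t)(log log t)²`, then every subgraph `H` on `t ≥ (1/2)·log n/(6k)²` vertices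
and every `1/t ≤ μ ≤ 2/3` admit `A ⊆ V(H)` with `μt/3 ≤ |A| ≤ μt` and
`φ_H(A) ≤ (log(1/μ)/log t)·(4 log log t)²`. -/
theorem stmt15 (n k : ℕ) (hk2 : 2 ≤ k)
    (hk : (k : ℝ) ≤ (1 / 648) * Real.logb 2 (Real.logb 2 (Real.logb 2 n)))
    (G : SimpleGraph (Fin n))
    (havg : (k : ℝ) * n ≤ 2 * G.edgeSet.ncard)
    (hmax : ∀ v : Fin n, (G.neighborSet v).ncard ≤ 6 * k)
    (hgirth : ∀ (v : Fin n) (w : G.Walk v v), w.IsCycle →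
      Real.logb 2 n / (6 * k : ℝ) ^ 2 ≤ (w.length : ℝ))
    (hsep : ∀ (H : G.Subgraph) (t : ℕ), H.verts.ncard = t →
      Real.logb 2 n / (6 * k : ℝ) ^ 2 ≤ (t : ℝ) →
      (sep H.coe : ℝ) ≤ ((t : ℝ) / Real.logb 2 t) * (Real.logb 2 (Real.logb 2 t)) ^ 2) :
    ∀ (H : G.Subgraph) (t : ℕ), H.verts.ncard = t →
      (1 / 2) * (Real.logb 2 n / (6 * k : ℝ) ^ 2) ≤ (t : ℝ) →
      ∀ μ : ℝ, 1 / (t : ℝ) ≤ μ → μ ≤ 2 / 3 →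
        ∃ A : Set ↥H.verts,
          μ * t / 3 ≤ (A.ncard : ℝ) ∧ (A.ncard : ℝ) ≤ μ * t ∧
          phi H.coe A ≤
            (Real.logb 2 (1 / μ) / Real.logb 2 t) *
              (4 * Real.logb 2 (Real.logb 2 t)) ^ 2 := by
  classical
  intro H t ht hgt μ hμ₁ hμ₂
  obtain ⟨ht₀, hX, hl⟩ := six_mul_le_loglog hk2 hk hgt
  set X := Real.logb 2 (t : ℝ) with hXdef
  set l := Real.logb 2 X with hldef
  set M := Real.logb 2 (1 / μ) with hM
  have hk2' : (2 : ℝ) ≤ k := by exact_mod_cast hk2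
  have hX₀ : 0 < X := by linarith
  have hμ₀ : 0 < μ := lt_of_lt_of_le (by positivity) hμ₁
  have hμt : 1 ≤ μ * t := by rwa [div_le_iff₀ ht₀] at hμ₁
  have hcard : Fintype.card H.verts = t := by
    rw [← ht, ← Nat.card_eq_fintype_card, Nat.card_coe_set_eq]
  rcases le_or_gt (X / 2) M with hcase | hcase
  · have hfl : ⌊μ * t⌋₊ ≤ (Finset.univ : Finset H.verts).card := by
      rw [Finset.card_univ, hcard]
      exact Nat.floor_le_of_le (by nlinarith)
    obtain ⟨A, -, hA⟩ := Finset.exists_subset_card_eq hfl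
    have h₁ : 1 ≤ ⌊μ * t⌋₊ := Nat.le_floor (by exact_mod_cast hμt)
    have h₁' : (1 : ℝ) ≤ (⌊μ * t⌋₊ : ℝ) := by exact_mod_cast h₁
    have h₂ := Nat.lt_floor_add_one (μ * t)
    refine ⟨(A : Set H.verts), ?_, ?_, ?_⟩
    · rw [Set.ncard_coe_finset, hA]
      linarith
    · rw [Set.ncard_coe_finset, hA]
      exact Nat.floor_le (by linarith)
    · have h₃ : phi H.coe (A : Set H.verts) ≤ 6 * k := by
        refine phi_le (by omega) ?_
        exact_mod_cast cutCount_le_mul H.coe (ncard_neighborSet_coe_le H hmax) A Aᶜ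
      have h₄ : 1 / 2 ≤ M / X := by
        rw [le_div_iff₀ hX₀]
        linarith
      nlinarith
  · have hmain := exists_small_boundary H.coe (β := 2 * l ^ 2 / X) (s := μ * t) ?_ Finset.univ
      (by rw [Finset.card_univ, hcard]; exact_mod_cast ht₀)
      (by rw [Finset.card_univ, hcard]; nlinarith) 0
      (by rw [Finset.card_univ]; simp) (by simp [cutCount])
    · obtain ⟨A, i, hA₁, hA₂, hi, hcut⟩ := hmain
      have hA₀ : (0 : ℝ) < A.card := by linarith
      refine ⟨(A : Set H.verts), by rwa [Set.ncard_coe_finset],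
        by rwa [Set.ncard_coe_finset], (phi_le (by exact_mod_cast hA₀) hcut).trans ?_⟩
      rw [hcard] at hi
      have hi' : (3 / 2 : ℝ) ^ i * μ ≤ 1 := by
        by_contra! hcon
        nlinarith
      have hiM := succ_le_four_mul_logb hμ₀ hμ₂ hi'
      calc 2 * (2 * l ^ 2 / X) * ((i : ℝ) + 1) ≤ 2 * (2 * l ^ 2 / X) * (4 * M) := by gcongr
        _ = M / X * (4 * l) ^ 2 := by ring
    · intro S hS
      have hS₁ : (1 : ℝ) < S.card := by linarith
      have hS₂ : 2 ≤ S.card := by exact_mod_cast hS₁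
      let K := H.induce (Subtype.val '' (S : Set H.verts))
      let f : K.coe ↪g H.coe := induceCoeEmbedding H (S : Set H.verts)
      have hmap : Finset.univ.map f.toEmbedding = S := by
        rw [← Finset.coe_inj, Finset.coe_map, Finset.coe_univ, Set.image_univ]
        exact range_induceCoeEmbedding H _
      have hKcard : Fintype.card K.verts = S.card := by
        rw [← Finset.card_univ, ← Finset.card_map f.toEmbedding, hmap]
      have hKncard : K.verts.ncard = S.card := by
        rw [← hKcard, ← Nat.card_eq_fintype_card, Nat.card_coe_set_eq]
      have hSt : (S.card : ℝ) ≤ t := by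
        rw [← hcard]
        exact_mod_cast S.card_le_univ
      have hY₁ : X / 2 ≤ Real.logb 2 S.card := by
        have h := Real.logb_le_logb_of_le one_lt_two (by positivity) hS.le
        rw [Real.logb_mul hμ₀.ne' ht₀.ne'] at h
        rw [hM, one_div, Real.logb_inv] at hcase
        linarith
      have hY₂ := Real.logb_le_logb_of_le one_lt_two (by linarith) hSt
      obtain ⟨hb₁, hb₂⟩ := sep_bound_uniform (d := 6 * k) (by linarith) hX hY₁ hY₂
        (by linarith) hl
      have hsepK : (sep K.coe : ℝ) ≤ 2 * l ^ 2 / X * S.card := by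
        rcases le_or_gt (Real.logb 2 n / (6 * k : ℝ) ^ 2) S.card with hg | hg
        · exact (hsep K S.card hKncard hg).trans hb₁
        · refine le_trans ?_ hb₂
          have hac : K.coe.IsAcyclic := isAcyclic_of_girth K.hom Subtype.val_injective
            fun v w hw => by
              rw [hKcard]
              exact_mod_cast hg.trans_le (hgirth v w hw)
          exact_mod_cast sep_le_of_isAcyclic hac (ncard_neighborSet_coe_le K hmax)
            (by rw [hKcard]; exact hS₂)
      obtain ⟨S₁, S₂, hd, hu, h₁, h₂, hc⟩ := exists_split_of_sep f (by rw [hKcard]; exact hS₂)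
      rw [hKcard] at h₁ h₂
      exact ⟨S₁, S₂, hd, hu.trans hmap, h₁, h₂, by rw [hc]; exact hsepK⟩
end

section
/- Let H be a graph and let S ⊆ V(H) be a subset with |S| ≥ 3. Then there exists a subset S₁ ⊆ S with |S|/3 ≤ |S₁| ≤ (2/3)·|S| such that φ_H(S₁) ≤ φ_H(S) + 2·sep(H[S])/|S|, where H[S] denotes the subgraph of H induced on S. -/
open SimpleGraph

/-- The edges of `G` with one endpoint in `A` and the other in `B`. -/
def edgesBetween {V : Type*} (G : SimpleGraph V) (A B : Set V) : Set (Sym2 V) :=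
  {e | ∃ u ∈ A, ∃ v ∈ B, G.Adj u v ∧ e = s(u, v)}

theorem cutEdges_union_subset {V : Type*} (G : SimpleGraph V) (A B : Set V) :
    cutEdges G A ∪ cutEdges G B ⊆ cutEdges G (A ∪ B) ∪ edgesBetween G A B := by
  rintro e (⟨he, u, hu, v, hv, rfl⟩ | ⟨he, u, hu, v, hv, rfl⟩)
  · by_cases hvB : v ∈ B
    · exact Or.inr ⟨u, hu, v, hvB, he, rfl⟩
    · exact Or.inl ⟨he, u, Or.inl hu, v, fun h => h.elim hv hvB, rfl⟩
  · by_cases hvA : v ∈ A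
    · exact Or.inr ⟨v, hvA, u, hu, G.adj_symm he, Sym2.eq_swap⟩
    · exact Or.inl ⟨he, u, Or.inr hu, v, fun h => h.elim hvA hv, rfl⟩

theorem cutEdges_inter_subset {V : Type*} (G : SimpleGraph V) {A B : Set V}
    (hAB : Disjoint A B) : cutEdges G A ∩ cutEdges G B ⊆ edgesBetween G A B := by
  rintro e ⟨⟨he, u, hu, v, hv, rfl⟩, -, u', hu', v', hv', heq⟩
  rcases Sym2.eq_iff.mp heq with ⟨rfl, rfl⟩ | ⟨rfl, rfl⟩
  · exact absurd hu' (Set.disjoint_left.mp hAB hu)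
  · exact ⟨u, hu, v, hu', he, rfl⟩

theorem ncard_cutEdges_add_le {V : Type*} [Finite V] (G : SimpleGraph V) {A B : Set V}
    (hAB : Disjoint A B) :
    (cutEdges G A).ncard + (cutEdges G B).ncard ≤
      (cutEdges G (A ∪ B)).ncard + 2 * (edgesBetween G A B).ncard := by
  have h₁ := Set.ncard_le_ncard (cutEdges_union_subset G A B) (Set.toFinite _)
  have h₂ := Set.ncard_le_ncard (cutEdges_inter_subset G hAB) (Set.toFinite _)
  have h₃ := Set.ncard_union_le (cutEdges G (A ∪ B)) (edgesBetween G A B)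
  have h₄ := Set.ncard_union_add_ncard_inter (cutEdges G A) (cutEdges G B)
  omega

theorem ncard_edgesBetween_image_le {V : Type*} [Finite V] (G : SimpleGraph V) (S : Set V)
    (A : Set S) :
    (edgesBetween G (Subtype.val '' A) (Subtype.val '' Aᶜ)).ncard ≤
      (cutEdges (G.induce S) A).ncard := by
  refine le_trans (Set.ncard_le_ncard (t := Sym2.map Subtype.val '' cutEdges (G.induce S) A)
    ?_ (Set.toFinite _)) (Set.ncard_image_le (Set.toFinite _))
  rintro e ⟨-, ⟨u, hu, rfl⟩, -, ⟨v, hv, rfl⟩, hadj, rfl⟩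
  exact ⟨s(u, v), ⟨hadj, u, hu, v, hv, rfl⟩, rfl⟩

/-- The minimum defining `sep` is attained on graphs with at least three vertices. -/
theorem exists_ncard_cutEdges_eq_sep {V : Type*} [Finite V] (G : SimpleGraph V)
    (hV : 3 ≤ Nat.card V) :
    ∃ A : Set V, 3 * A.ncard ≤ 2 * Nat.card V ∧ 3 * Aᶜ.ncard ≤ 2 * Nat.card V ∧
      sep G = (cutEdges G A).ncard := by
  refine Nat.sInf_mem (s := { m : ℕ | ∃ A : Set V, 3 * A.ncard ≤ 2 * Nat.card V ∧
      3 * Aᶜ.ncard ≤ 2 * Nat.card V ∧ m = (cutEdges G A).ncard }) ?_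
  obtain ⟨A, -, hA⟩ := Set.exists_subset_card_eq (s := (Set.univ : Set V))
    (n := Nat.card V / 2) (by rw [Set.ncard_univ]; omega)
  have h := Set.ncard_add_ncard_compl A
  exact ⟨_, A, by omega, by omega, rfl⟩

theorem div_le_or_div_le_of_add_le {a b x y c : ℝ} (ha : 0 < a) (hb : 0 < b)
    (h : x + y ≤ c * (a + b)) : x / a ≤ c ∨ y / b ≤ c := by
  rw [div_le_iff₀ ha, div_le_iff₀ hb]
  by_contra! hc
  linarith [hc.1, hc.2]

/-- Key step in the proof of Theorem 1.4: for every graph `H` and every `S ⊆ V(H)` with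
`|S| ≥ 3` there is `S₁ ⊆ S` with `|S|/3 ≤ |S₁| ≤ (2/3)|S|` such that
`φ_H(S₁) ≤ φ_H(S) + 2·sep(H[S])/|S|`. -/
theorem stmt16 {V : Type} [Fintype V] (H : SimpleGraph V)
    (S : Set V) (hS : 3 ≤ S.ncard) :
    ∃ S₁ : Set V, S₁ ⊆ S ∧
      (S.ncard : ℝ) / 3 ≤ (S₁.ncard : ℝ) ∧
      (S₁.ncard : ℝ) ≤ (2 / 3) * (S.ncard : ℝ) ∧
      phi H S₁ ≤ phi H S + 2 * (sep (H.induce S) : ℝ) / (S.ncard : ℝ) := by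
  have hcard : Nat.card S = S.ncard := Nat.card_coe_set_eq S
  obtain ⟨A, hA, hB, hsep⟩ := exists_ncard_cutEdges_eq_sep (H.induce S) (by omega)
  have hsum := Set.ncard_add_ncard_compl A
  have hdisj : Disjoint (Subtype.val '' A) (Subtype.val '' Aᶜ) :=
    (Set.disjoint_image_iff Subtype.val_injective).mpr disjoint_compl_right
  have hunion : Subtype.val '' A ∪ Subtype.val '' Aᶜ = S := by
    rw [← Set.image_union, Set.union_compl_self, Set.image_univ, Subtype.range_coe]
  have hcut := ncard_cutEdges_add_le H hdisj
  have hbetween := ncard_edgesBetween_image_le H S A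
  rw [hunion] at hcut
  rw [← hsep] at hbetween
  have hAcard := Set.ncard_image_of_injective A Subtype.val_injective
  have hBcard := Set.ncard_image_of_injective Aᶜ Subtype.val_injective
  rw [hcard] at hA hB hsum
  rw [← hAcard] at hA hsum
  rw [← hBcard] at hB hsum
  generalize Subtype.val '' A = P at *
  generalize Subtype.val '' Aᶜ = Q at *
  have hPS : P ⊆ S := hunion ▸ Set.subset_union_left
  have hQS : Q ⊆ S := hunion ▸ Set.subset_union_right
  have hle : (cutEdges H P).ncard + (cutEdges H Q).ncard ≤
      (cutEdges H S).ncard + 2 * sep (H.induce S) := by omega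
  have hPpos : (0 : ℝ) < P.ncard := by exact_mod_cast (by omega : 0 < P.ncard)
  have hQpos : (0 : ℝ) < Q.ncard := by exact_mod_cast (by omega : 0 < Q.ncard)
  have hsumR : (P.ncard : ℝ) + Q.ncard = S.ncard := by exact_mod_cast hsum
  have hAR : 3 * (P.ncard : ℝ) ≤ 2 * S.ncard := by exact_mod_cast hA
  have hBR : 3 * (Q.ncard : ℝ) ≤ 2 * S.ncard := by exact_mod_cast hB
  have hleR : ((cutEdges H P).ncard : ℝ) + (cutEdges H Q).ncard ≤
      (cutEdges H S).ncard + 2 * sep (H.induce S) := by exact_mod_cast hle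
  have hmediant : ((cutEdges H P).ncard : ℝ) + (cutEdges H Q).ncard ≤
      (phi H S + 2 * (sep (H.induce S) : ℝ) / (S.ncard : ℝ)) * (P.ncard + Q.ncard) := by
    have hSne : (S.ncard : ℝ) ≠ 0 := by linarith
    rw [hsumR, phi, ← add_div, div_mul_cancel₀ _ hSne]
    exact hleR
  rcases div_le_or_div_le_of_add_le hPpos hQpos hmediant with h | h
  · exact ⟨P, hPS, by linarith, by linarith, h⟩
  · exact ⟨Q, hQS, by linarith, by linarith, h⟩
end

section
/- Let G be a connected graph on n vertices with edge expansion at least α > 0, i.e., every nonempty S ⊆ V(G) with |S| ≤ n/2 satisfies |∂_G(S)| ≥ α·|S|, and let e be an edge of G lying on a cycle of G. Then the graph G − e obtained by deleting e has edge expansion at least α/2, i.e., every nonempty S ⊆ V(G) with |S| ≤ n/2 satisfies |∂_{G−e}(S)| ≥ (α/2)·|S|. -/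
open SimpleGraph

/-- In a connected graph every nonempty proper vertex set has a nonempty edge boundary. -/
lemma SimpleGraph.Connected.cutEdges_nonempty {V : Type*} {G : SimpleGraph V} (hG : G.Connected)
    {S : Set V} (hS : S.Nonempty) (hS' : S ≠ Set.univ) : (cutEdges G S).Nonempty := by
  obtain ⟨u, hu⟩ := hS
  obtain ⟨v, hv⟩ := (Set.ne_univ_iff_exists_notMem S).1 hS'
  obtain ⟨p⟩ := hG.preconnected u v
  obtain ⟨d, -, hd, hd'⟩ := p.exists_boundary_dart S hu hv
  exact ⟨s(d.fst, d.snd), d.adj, d.fst, hd, d.snd, hd', rfl⟩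

/-- Deleting one edge removes at most that edge from an edge boundary. -/
lemma cutEdges_subset_insert_cutEdges_deleteEdges {V : Type*} (G : SimpleGraph V) (e : Sym2 V)
    (S : Set V) : cutEdges G S ⊆ insert e (cutEdges (G.deleteEdges {e}) S) := by
  rintro f ⟨hf, hcut⟩
  rcases eq_or_ne f e with rfl | hne
  · exact Set.mem_insert f _
  · refine Set.mem_insert_of_mem e ⟨?_, hcut⟩
    rw [edgeSet_deleteEdges]
    exact ⟨hf, hne⟩

/-- Deleting an edge that lies on a cycle preserves connectedness. -/
lemma SimpleGraph.Connected.deleteEdges_of_mem_cycle {V : Type*} {G : SimpleGraph V}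
    (hG : G.Connected) {e : Sym2 V} {v : V} {w : G.Walk v v} (hw : w.IsCycle)
    (he : e ∈ w.edges) : (G.deleteEdges {e}).Connected := by
  induction e with
  | h x y =>
    exact hG.connected_delete_edge_of_not_isBridge fun hb => hb.notMem_edges_of_isCycle hw he

/-- Step in the proof of Lemma 3.5: if `G` is a connected `n`-vertex graph with edge
expansion at least `α > 0` and `e` is an edge of `G` lying on a cycle, then `G − e` has
edge expansion at least `α/2`. -/
theorem stmt17 {V : Type} [Fintype V] (G : SimpleGraph V) (n : ℕ)
    (hn : Fintype.card V = n) (hconn : G.Connected)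
    (α : ℝ) (hα : 0 < α)
    (hexp : ∀ S : Set V, S.Nonempty → (S.ncard : ℝ) ≤ (n : ℝ) / 2 →
      α * (S.ncard : ℝ) ≤ ((cutEdges G S).ncard : ℝ))
    (e : Sym2 V) (he : e ∈ G.edgeSet)
    (hcyc : ∃ (v : V) (w : G.Walk v v), w.IsCycle ∧ e ∈ w.edges) :
    ∀ S : Set V, S.Nonempty → (S.ncard : ℝ) ≤ (n : ℝ) / 2 →
      (α / 2) * (S.ncard : ℝ) ≤ ((cutEdges (G.deleteEdges {e}) S).ncard : ℝ) := by
  intro S hS hSn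
  obtain ⟨v, w, hw, hew⟩ := hcyc
  have hS' : S ≠ Set.univ := by
    rintro rfl
    have hpos : 0 < (Set.univ : Set V).ncard := (Set.ncard_pos).2 hS
    rw [Set.ncard_univ, Nat.card_eq_fintype_card, hn] at hSn hpos
    have : (0 : ℝ) < n := by exact_mod_cast hpos
    linarith
  have hone : 1 ≤ (cutEdges (G.deleteEdges {e}) S).ncard :=
    (Set.ncard_pos).2 ((hconn.deleteEdges_of_mem_cycle hw hew).cutEdges_nonempty hS hS')
  have hle : (cutEdges G S).ncard ≤ (cutEdges (G.deleteEdges {e}) S).ncard + 1 :=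
    (Set.ncard_le_ncard (cutEdges_subset_insert_cutEdges_deleteEdges G e S)).trans
      (Set.ncard_insert_le e _)
  have htwo : ((cutEdges G S).ncard : ℝ) ≤ 2 * (cutEdges (G.deleteEdges {e}) S).ncard := by
    exact_mod_cast (by lia :
      (cutEdges G S).ncard ≤ 2 * (cutEdges (G.deleteEdges {e}) S).ncard)
  linarith [hexp S hS hSn]
end
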